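/- Let ℓ ≥ 1 and let m_1, …, m_ℓ be integers with each m_i ≥ 2; set s = m_1 + … + m_ℓ, let t > s be an integer, and let a be the number of odd entries among m_1, …, m_ℓ. Assume a ≤ 2⌊t/2⌋ − s. If OP*(m_1, …, m_ℓ) has a solution, then: (1) OP*(m_1, …, m_ℓ, t) has a solution; and (2) if t is even, OP*(m_1, …, m_ℓ, 2^⟨t/2⟩) has a solution (the list m_1, …, m_ℓ followed by t/2 copies of 2). -/

import Mathlib

/-- A solution to the directed Oberwolfach problem OP*(m₁, …, m_k). -/
def HasOPSolution (m : List ℕ) : Prop :=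
  ∃ σ : Fin (m.sum - 1) → Equiv.Perm (Fin m.sum),
    (∀ i, (σ i).cycleType = (m : Multiset ℕ)) ∧
    ∀ x y : Fin m.sum, x ≠ y → ∃! i, σ i x = y

namespace Oberwolfach

open Equiv Equiv.Perm

section Assembly

variable {α β : Type*} [Fintype α] [DecidableEq α] [Fintype β] [DecidableEq β]

theorem cycleType_sumCongr_one (σ : Perm α) :
    (Perm.sumCongr σ (1 : Perm β)).cycleType = σ.cycleType := by
  let f : α ≃ {x : α ⊕ β // x.isLeft = true} :=
    { toFun := fun a => ⟨Sum.inl a, rfl⟩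
      invFun := fun x => x.1.getLeft x.2
      left_inv := fun a => rfl
      right_inv := by rintro ⟨x | x, hx⟩ <;> simp_all }
  rw [← cycleType_extendDomain f (g := σ)]
  congr 1
  ext x
  rcases x with x | x
  · rw [show (Sum.inl x : α ⊕ β) = f x from rfl, extendDomain_apply_image]
    rfl
  · rw [extendDomain_apply_not_subtype _ _ (by simp)]
    rfl

theorem cycleType_one_sumCongr (τ : Perm β) :
    (Perm.sumCongr (1 : Perm α) τ).cycleType = τ.cycleType := by
  let f : β ≃ {x : α ⊕ β // x.isRight = true} :=
    { toFun := fun a => ⟨Sum.inr a, rfl⟩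
      invFun := fun x => x.1.getRight x.2
      left_inv := fun a => rfl
      right_inv := by rintro ⟨x | x, hx⟩ <;> simp_all }
  rw [← cycleType_extendDomain f (g := τ)]
  congr 1
  ext x
  rcases x with x | x
  · rw [extendDomain_apply_not_subtype _ _ (by simp)]
    rfl
  · rw [show (Sum.inr x : α ⊕ β) = f x from rfl, extendDomain_apply_image]
    rfl

theorem cycleType_sumCongr (σ : Perm α) (τ : Perm β) :
    (Perm.sumCongr σ τ).cycleType = σ.cycleType + τ.cycleType := by
  have h : Perm.sumCongr σ τ = Perm.sumCongr σ 1 * Perm.sumCongr 1 τ := by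
    rw [sumCongr_mul]; simp
  rw [h, Disjoint.cycleType_mul, cycleType_sumCongr_one, cycleType_one_sumCongr]
  rintro (x | x)
  · right; simp
  · left; simp

theorem cycleType_permCongr (e : α ≃ β) (σ : Perm α) :
    (e.permCongr σ).cycleType = σ.cycleType := by
  let f : α ≃ {x : β // True} := e.trans (Equiv.Set.univ β).symm
  rw [← cycleType_extendDomain f (g := σ)]
  congr 1

/-- A family of permutations of the right size that covers every ordered pair is a solution. -/
theorem hasOPSolution_of_cover {ι : Type*} [Fintype ι] (m : List ℕ)
    (hα : Fintype.card α = m.sum) (hι : Fintype.card ι = m.sum - 1)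
    (σ : ι → Perm α) (hσ : ∀ i, (σ i).cycleType = (m : Multiset ℕ))
    (hcov : ∀ x y, x ≠ y → ∃ i, σ i x = y) : HasOPSolution m := by
  let e : α ≃ Fin m.sum := Fintype.equivFinOfCardEq hα
  let j : ι ≃ Fin (m.sum - 1) := Fintype.equivFinOfCardEq hι
  refine ⟨fun i => e.permCongr (σ (j.symm i)), fun i => by rw [cycleType_permCongr, hσ], ?_⟩
  intro x y hxy
  have hfix : ∀ i, ∀ z, σ i z ≠ z := by
    intro i z
    have h1 : (σ i).support.card = Fintype.card α := by
      rw [← sum_cycleType, hσ, hα]; simp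
    have h2 : z ∈ (σ i).support := by
      rw [(Finset.card_eq_iff_eq_univ _).1 h1]; simp
    simpa using h2
  obtain ⟨i, hi⟩ := hcov (e.symm x) (e.symm y) (by simpa using hxy)
  refine ⟨j i, by simp [permCongr_apply, hi], ?_⟩
  -- the map `i ↦ σ i x` is a surjection between finite sets of equal size
  let z := e.symm x
  let F : ι → {w : α // w ≠ z} := fun i => ⟨σ i z, hfix i z⟩
  have hF : Function.Surjective F := by
    rintro ⟨w, hw⟩
    obtain ⟨i, hi⟩ := hcov z w (Ne.symm hw)
    exact ⟨i, Subtype.ext hi⟩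
  have hcard : Fintype.card ι = Fintype.card {w : α // w ≠ z} := by
    rw [hι, Fintype.card_subtype_compl, hα, Fintype.card_subtype_eq]
  have hb := (Fintype.bijective_iff_surjective_and_card F).2 ⟨hF, hcard⟩
  intro k hk
  have : F (j.symm k) = F i := by
    apply Subtype.ext
    change σ (j.symm k) z = σ i z
    rw [hi]
    have := congrArg e.symm hk
    simpa [permCongr_apply] using this
  rw [← hb.1 this]; simp

/-- `D` is a list of differences covered by as many permutations of cycle type `T`. -/
def Factorable (T : Multiset ℕ) (t : ℕ) [NeZero t] (D : List (ZMod t)) : Prop :=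
  ∃ l : List (Perm (ZMod t)), l.length = D.length ∧ (∀ σ ∈ l, σ.cycleType = T) ∧
    ∀ y, ∀ d ∈ D, ∃ σ ∈ l, σ y = y + d

theorem Factorable.nil (T : Multiset ℕ) (t : ℕ) [NeZero t] : Factorable T t [] :=
  ⟨[], by simp⟩

theorem Factorable.append {T : Multiset ℕ} {t : ℕ} [NeZero t] {D D' : List (ZMod t)}
    (h : Factorable T t D) (h' : Factorable T t D') : Factorable T t (D ++ D') := by
  obtain ⟨l, h1, h2, h3⟩ := h
  obtain ⟨l', h1', h2', h3'⟩ := h'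
  refine ⟨l ++ l', by simp [h1, h1'], ?_, ?_⟩
  · intro σ hσ
    rcases List.mem_append.1 hσ with h | h
    · exact h2 σ h
    · exact h2' σ h
  · intro y d hd
    rcases List.mem_append.1 hd with h | h
    · obtain ⟨σ, hσ, h⟩ := h3 y d h
      exact ⟨σ, List.mem_append_left _ hσ, h⟩
    · obtain ⟨σ, hσ, h⟩ := h3' y d h
      exact ⟨σ, List.mem_append_right _ hσ, h⟩

/-- Gluing a solution on `m` to the rotations of a base permutation. -/
theorem hasOPSolution_of_base (m m' T : List ℕ) (t : ℕ) [NeZero t]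
    (hs : 0 < m.sum)
    (hTt : T.sum = t) (hm' : m' = m ++ T) (hsol : HasOPSolution m)
    (D : List (ZMod t)) (hD : Factorable (T : Multiset ℕ) t D) (hlen : D.length = m.sum - 1)
    (β : Perm (Fin m.sum ⊕ ZMod t)) (hβ : β.cycleType = (m' : Multiset ℕ))
    (hX : ∀ x, ∃ y, β (Sum.inl x) = Sum.inr y)
    (hY : ∀ d : ZMod t, d ≠ 0 → d ∈ D ∨ ∃ y, β (Sum.inr y) = Sum.inr (y + d)) :
    HasOPSolution m' := by
  subst hm'
  obtain ⟨σ, hσ, hσc⟩ := hsol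
  obtain ⟨l, hl, hlT, hlc⟩ := hD
  have hl' : l.length = m.sum - 1 := hl.trans hlen
  let τ : ZMod t → Perm (Fin m.sum ⊕ ZMod t) := fun c => Perm.sumCongr 1 (Equiv.addRight c)
  let f : Fin (m.sum - 1) ⊕ ZMod t → Perm (Fin m.sum ⊕ ZMod t) :=
    Sum.elim (fun i => Perm.sumCongr (σ i) (l.get (i.cast hl'.symm))) (fun c => τ c * β * (τ c)⁻¹)
  have τinr : ∀ c y, τ c (Sum.inr y) = Sum.inr (y + c) := fun c y => rfl
  have τinl : ∀ c x, τ c (Sum.inl x) = Sum.inl x := fun c x => rfl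
  have τinr' : ∀ c y, (τ c)⁻¹ (Sum.inr y) = Sum.inr (y - c) := by
    intro c y
    rw [Perm.inv_eq_iff_eq, τinr]; simp
  have τinl' : ∀ c x, (τ c)⁻¹ (Sum.inl x) = Sum.inl x := by
    intro c y
    rw [Perm.inv_eq_iff_eq, τinl]
  refine hasOPSolution_of_cover (α := Fin m.sum ⊕ ZMod t) (m ++ T) ?_ ?_ f ?_ ?_
  · simp [hTt]
  · simp [hTt]; omega
  · rintro (i | c)
    · change (Perm.sumCongr _ _).cycleType = _
      rw [cycleType_sumCongr, hσ, hlT _ (List.get_mem _ _)]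
      simp
    · change (τ c * β * (τ c)⁻¹).cycleType = _
      rw [cycleType_conj, hβ]
  · rintro (x | x) (y | y) hxy
    · obtain ⟨i, hi, -⟩ := hσc x y (by simpa using hxy)
      exact ⟨Sum.inl i, by simp [f, hi]⟩
    · obtain ⟨y0, hy0⟩ := hX x
      refine ⟨Sum.inr (y - y0), ?_⟩
      simp only [f, Sum.elim_inr, Perm.mul_apply]
      rw [τinl', hy0, τinr]; simp
    · obtain ⟨w, hw⟩ : ∃ w, β (Sum.inr w) = Sum.inl y := by
        rcases h : β.symm (Sum.inl y) with x' | w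
        · obtain ⟨y', hy'⟩ := hX x'
          rw [← h, apply_symm_apply] at hy'
          simp at hy'
        · exact ⟨w, by rw [← h, apply_symm_apply]⟩
      refine ⟨Sum.inr (x - w), ?_⟩
      simp only [f, Sum.elim_inr, Perm.mul_apply]
      rw [τinr', sub_sub_cancel, hw, τinl]
    · have hne : y - x ≠ 0 := by
        intro h; apply hxy; rw [sub_eq_zero.1 h]
      rcases hY (y - x) hne with h | ⟨w, hw⟩
      · obtain ⟨ρ, hρ, h⟩ := hlc x _ h
        obtain ⟨k, hk⟩ := List.get_of_mem hρ
        refine ⟨Sum.inl (k.cast hl'), ?_⟩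
        simp only [f, Sum.elim_inl]
        rw [show ((k.cast hl').cast hl'.symm) = k from rfl, hk]
        simp [h]
      · refine ⟨Sum.inr (x - w), ?_⟩
        simp only [f, Sum.elim_inr, Perm.mul_apply]
        rw [τinr', sub_sub_cancel, hw, τinr]
        congr 1; ring

end Assembly
end Oberwolfach

namespace Oberwolfach

open Equiv Equiv.Perm

section Base

variable {Y : Type*} [Fintype Y] [DecidableEq Y]

theorem formPerm_apply_of_infix {α : Type*} {c : List α} {u v : α} (hc : c.Nodup)
    [DecidableEq α] (h : [u, v] <:+: c) : c.formPerm u = v := by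
  obtain ⟨l₁, l₂, rfl⟩ := h
  have := List.formPerm_apply_lt_getElem (l₁ ++ [u, v] ++ l₂) hc l₁.length (by simp)
  simpa using this

theorem prod_map_formPerm_apply {α : Type*} [DecidableEq α] {C : List (List α)}
    (hC : C.flatten.Nodup) {c : List α} (hc : c ∈ C) {u : α} (hu : u ∈ c) :
    (C.map List.formPerm).prod u = c.formPerm u := by
  induction C with
  | nil => simp at hc
  | cons a C ih =>
    rw [List.flatten_cons, List.nodup_append] at hC
    obtain ⟨h1, h2, h3⟩ := hC
    simp only [List.map_cons, List.prod_cons, Perm.mul_apply]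
    have key : ∀ w ∈ a, (C.map List.formPerm).prod w = w := by
      intro w hw
      have : ∀ c ∈ C, w ∉ c := fun c hc hwc =>
        h3 w hw w (List.mem_flatten.2 ⟨c, hc, hwc⟩) rfl
      clear ih h1 h2 h3 hc
      induction C with
      | nil => simp
      | cons b C ih =>
        simp only [List.map_cons, List.prod_cons, Perm.mul_apply]
        rw [ih (fun c hc => this c (List.mem_cons_of_mem _ hc)),
          List.formPerm_apply_of_notMem (this b List.mem_cons_self)]
    rcases List.mem_cons.1 hc with rfl | hc
    · rw [key u hu]
    · rw [ih h2 hc]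
      apply List.formPerm_apply_of_notMem
      intro hmem
      refine h3 _ hmem _ (List.mem_flatten.2 ⟨c, hc, ?_⟩) rfl
      exact List.formPerm_apply_mem_of_mem hu

theorem cycleType_prod_map_formPerm {α : Type*} [DecidableEq α] [Fintype α] {C : List (List α)}
    (hC : C.flatten.Nodup) (h2 : ∀ c ∈ C, 2 ≤ c.length) :
    (C.map List.formPerm).prod.cycleType = (C.map List.length : Multiset ℕ) := by
  rw [List.nodup_flatten] at hC
  rw [cycleType_eq (C.map List.formPerm) rfl]
  · rw [List.map_map]
    congr 1
    apply List.map_congr_left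
    intro c hc
    have hnd := hC.1 c hc
    have h2c := h2 c hc
    simp only [Function.comp]
    rw [List.support_formPerm_of_nodup _ hnd, List.toFinset_card_of_nodup hnd]
    rintro x rfl
    simp at h2c
  · intro σ hσ
    obtain ⟨c, hc, rfl⟩ := List.mem_map.1 hσ
    exact List.isCycle_formPerm (hC.1 c hc) (h2 c hc)
  · rw [List.pairwise_map]
    refine hC.2.imp_of_mem ?_
    intro a b ha hb hab
    exact (List.formPerm_disjoint_iff (hC.1 a ha) (hC.1 b hb) (h2 a ha) (h2 b hb)).2 hab

theorem three_mul_odd_le (m : List ℕ) (hm : ∀ x ∈ m, 2 ≤ x) :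
    3 * (m.filter (fun x => x % 2 = 1)).length ≤ m.sum := by
  induction m with
  | nil => simp
  | cons x m ih =>
    have := ih fun y hy => hm y (List.mem_cons_of_mem _ hy)
    have hx := hm x List.mem_cons_self
    rcases Nat.mod_two_eq_zero_or_one x with h0 | h1
    · rw [List.filter_cons_of_neg (by simp [h0]), List.sum_cons]; omega
    · rw [List.filter_cons_of_pos (by simp [h1]), List.sum_cons, List.length_cons]; omega

/-- The cycle obtained from a block of paths by placing a labelled new vertex in front of each. -/
def blockCycle {s : ℕ} (f : List Y → Fin s) (B : List (List Y)) : List (Fin s ⊕ Y) :=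
  B.flatMap fun P => Sum.inl (f P) :: P.map Sum.inr

theorem exists_label {α : Type*} [DecidableEq α] {s : ℕ} (hs : 0 < s) (l : List α)
    (hl : l.Nodup) (hlen : l.length = s) :
    ∃ f : α → Fin s, ∀ x, ∃ y ∈ l, f y = x := by
  refine ⟨fun y => if h : l.idxOf y < s then ⟨l.idxOf y, h⟩ else ⟨0, hs⟩, fun x => ?_⟩
  refine ⟨l[x.1]'(by omega), List.getElem_mem _, ?_⟩
  simp [hl.idxOf_getElem]

omit [Fintype Y] [DecidableEq Y] in
theorem length_blockCycle {s : ℕ} (f : List Y → Fin s) (B : List (List Y)) :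
    (blockCycle f B).length = B.length + B.flatten.length := by
  induction B with
  | nil => rfl
  | cons P B ih =>
    simp [blockCycle] at ih ⊢
    omega

/-- Base permutation built from blocks of paths and extra transpositions. -/
theorem exists_base {s : ℕ} (hs : 0 < s) (C : List (List (List Y))) (E : List (Y × Y))
    (hne : ∀ B ∈ C, B ≠ [] ∧ ∀ P ∈ B, P ≠ []) (hpaths : (C.map List.length).sum = s)
    (hcov : ∀ y, y ∈ C.flatten.flatten ∨ ∃ e ∈ E, y = e.1 ∨ y = e.2)
    (hcard : C.flatten.flatten.length + 2 * E.length = Fintype.card Y) :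
    ∃ β : Perm (Fin s ⊕ Y),
      β.cycleType = (C.map (fun B => B.length + B.flatten.length) ++
        List.replicate E.length 2 : List ℕ) ∧
      (∀ x, ∃ y, β (Sum.inl x) = Sum.inr y) ∧
      (∀ B ∈ C, ∀ P ∈ B, ∀ u v, [u, v] <:+: P → β (Sum.inr u) = Sum.inr v) ∧
      (∀ e ∈ E, β (Sum.inr e.1) = Sum.inr e.2 ∧ β (Sum.inr e.2) = Sum.inr e.1) := by
  classical
  have hlenC : C.flatten.length = s := by rw [List.length_flatten, hpaths]
  have hneP : ∀ P ∈ C.flatten, P ≠ [] := by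
    intro P hP
    obtain ⟨B, hB, hPB⟩ := List.mem_flatten.1 hP
    exact (hne B hB).2 P hPB
  have hYnd : (C.flatten.flatten ++ E.flatMap (fun e => [e.1, e.2])).Nodup := by
    refine Multiset.coe_nodup.1 (Multiset.toFinset_card_eq_card_iff_nodup.1 ?_)
    rw [List.toFinset_coe, Multiset.coe_card]
    rw [show (C.flatten.flatten ++ E.flatMap (fun e => [e.1, e.2])).toFinset = Finset.univ from ?_,
      Finset.card_univ, ← hcard]
    · simp; omega
    · ext y
      have := hcov y
      simp only [List.mem_toFinset, List.mem_append, List.mem_flatMap, Finset.mem_univ, iff_true]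
      simpa using this
  have hCnd : C.flatten.Nodup := by
    have := List.nodup_flatten.1 (List.nodup_append.1 hYnd).1
    refine (this.2.imp_of_mem ?_)
    rintro a b ha hb hab rfl
    obtain ⟨x, a, rfl⟩ := List.exists_cons_of_ne_nil (hneP _ ha)
    exact hab List.mem_cons_self List.mem_cons_self
  obtain ⟨f, hf⟩ := exists_label hs C.flatten hCnd hlenC
  let K : List (List (Fin s ⊕ Y)) :=
    C.map (blockCycle f) ++ E.map (fun e => [Sum.inr e.1, Sum.inr e.2])
  have hmemK : ∀ B ∈ C, blockCycle f B ∈ K := fun B hB =>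
    List.mem_append_left _ (List.mem_map_of_mem hB)
  have hmemE : ∀ e ∈ E, [Sum.inr e.1, Sum.inr e.2] ∈ K := fun e he =>
    List.mem_append_right _ (List.mem_map.2 ⟨e, he, rfl⟩)
  have hlens : K.map List.length = C.map (fun B => B.length + B.flatten.length) ++
        List.replicate E.length 2 := by
    simp [K, Function.comp_def, length_blockCycle]
  have hKlen : K.flatten.length = s + Fintype.card Y := by
    rw [List.length_flatten, hlens, List.sum_append, List.sum_map_add, hpaths, ← hcard]
    simp only [List.length_flatten, List.map_flatten, List.sum_flatten, List.map_map,
      List.sum_replicate, Function.comp_def]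
    simp; omega
  have hinfix : ∀ B : List (List Y), ∀ P ∈ B,
      (Sum.inl (f P) :: P.map Sum.inr) <:+: blockCycle f B := by
    intro B P hP
    obtain ⟨B₁, B₂, rfl⟩ := List.append_of_mem hP
    refine ⟨blockCycle f B₁, blockCycle f B₂, ?_⟩
    simp [blockCycle]
  have hKnd : K.flatten.Nodup := by
    refine Multiset.coe_nodup.1 (Multiset.toFinset_card_eq_card_iff_nodup.1 ?_)
    rw [List.toFinset_coe, Multiset.coe_card, hKlen]
    rw [show K.flatten.toFinset = Finset.univ from ?_, Finset.card_univ]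
    · simp
    · ext y
      simp only [List.mem_toFinset, Finset.mem_univ, iff_true, List.mem_flatten]
      rcases y with x | y
      · obtain ⟨P, hP, rfl⟩ := hf x
        obtain ⟨B, hB, hPB⟩ := List.mem_flatten.1 hP
        exact ⟨_, hmemK B hB, (hinfix B P hPB).subset List.mem_cons_self⟩
      · rcases hcov y with h | ⟨e, he, h⟩
        · obtain ⟨P, hP, hy⟩ := List.mem_flatten.1 h
          obtain ⟨B, hB, hPB⟩ := List.mem_flatten.1 hP
          exact ⟨_, hmemK B hB, (hinfix B P hPB).subset
            (List.mem_cons_of_mem _ (List.mem_map_of_mem hy))⟩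
        · refine ⟨_, hmemE e he, ?_⟩
          rcases h with rfl | rfl <;> simp
  have happ : ∀ c ∈ K, ∀ u v, [u, v] <:+: c → (K.map List.formPerm).prod u = v := by
    intro c hc u v h
    rw [prod_map_formPerm_apply hKnd hc (h.subset (by simp))]
    exact formPerm_apply_of_infix ((List.nodup_flatten.1 hKnd).1 c hc) h
  refine ⟨(K.map List.formPerm).prod, ?_, ?_, ?_, ?_⟩
  · rw [cycleType_prod_map_formPerm hKnd, hlens]
    intro c hc
    rcases List.mem_append.1 hc with h | h
    · obtain ⟨B, hB, rfl⟩ := List.mem_map.1 h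
      obtain ⟨h1, h2⟩ := hne B hB
      obtain ⟨P, B, rfl⟩ := List.exists_cons_of_ne_nil h1
      obtain ⟨x, P, rfl⟩ := List.exists_cons_of_ne_nil (h2 P List.mem_cons_self)
      rw [length_blockCycle]
      simp; omega
    · obtain ⟨e, -, rfl⟩ := List.mem_map.1 h
      simp
  · intro x
    obtain ⟨P, hP, rfl⟩ := hf x
    obtain ⟨B, hB, hPB⟩ := List.mem_flatten.1 hP
    obtain ⟨y, P, rfl⟩ := List.exists_cons_of_ne_nil (hneP P hP)
    refine ⟨y, happ _ (hmemK B hB) _ _ (List.IsInfix.trans ?_ (hinfix B _ hPB))⟩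
    exact ⟨[], P.map Sum.inr, by simp⟩
  · intro B hB P hP u v h
    refine happ _ (hmemK B hB) _ _ (List.IsInfix.trans ?_ (hinfix B _ hP))
    exact (h.map Sum.inr).trans ⟨[Sum.inl (f P)], [], by simp⟩
  · intro e he
    have h1 := happ _ (hmemE e he) _ _ (List.infix_refl _)
    refine ⟨h1, ?_⟩
    have hnd := (List.nodup_flatten.1 hKnd).1 _ (hmemE e he)
    rw [prod_map_formPerm_apply hKnd (hmemE e he) (by simp)]
    simp [Equiv.swap_apply_right]

/-- Distributing isolated edges and singletons over the cycles of lengths `m`. -/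
theorem exists_blocks {Y : Type*} (m : List ℕ) (hm : ∀ x ∈ m, 2 ≤ x) :
    ∀ (E : List (Y × Y)) (R : List Y), E.length = (m.filter (fun x => x % 2 = 1)).length →
      m.sum ≤ 2 * R.length + 3 * E.length →
      ∃ (B : List (List (List Y))) (R' : List Y),
        B.map (fun B => B.length + B.flatten.length) = m ∧
        (∀ b ∈ B, b ≠ [] ∧ ∀ P ∈ b, P ≠ []) ∧
        (B.flatten ++ R'.map (fun y => [y])).Perm
          (E.map (fun e => [e.1, e.2]) ++ R.map (fun y => [y])) ∧
        m.sum + 2 * R'.length = 2 * R.length + 3 * E.length := by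
  induction m with
  | nil =>
    intro E R hE _
    obtain rfl : E = [] := by simpa using hE
    exact ⟨[], R, by simp⟩
  | cons x m ih =>
    intro E R hE hR
    have hm' : ∀ x ∈ m, 2 ≤ x := fun y hy => hm y (List.mem_cons_of_mem _ hy)
    have hx := hm x List.mem_cons_self
    rw [List.sum_cons] at hR
    have hsplit : ∀ k, k ≤ R.length → R = R.take k ++ R.drop k := by simp
    rcases Nat.mod_two_eq_zero_or_one x with h0 | h1
    · rw [List.filter_cons_of_neg (by simp [h0])] at hE
      obtain ⟨k, rfl⟩ : ∃ k, x = 2 * k := ⟨x / 2, by omega⟩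
      -- enough singletons remain
      have hodd : 3 * E.length ≤ m.sum := by
        rw [hE]; exact three_mul_odd_le m hm'
      have hk : k ≤ R.length := by omega
      obtain ⟨B, R', h1, h2, h3, h4⟩ := ih hm' E (R.drop k) hE (by simp; omega)
      refine ⟨((R.take k).map fun y => [y]) :: B, R', ?_, ?_, ?_, ?_⟩
      · rw [List.map_cons, h1]
        congr 1
        simp [Function.comp_def]; omega
      · intro b hb
        rcases List.mem_cons.1 hb with rfl | hb
        · refine ⟨?_, fun P hP => ?_⟩
          rotate_left
          · obtain ⟨y, -, rfl⟩ := List.mem_map.1 hP; simp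
          simp only [ne_eq, List.map_eq_nil_iff, List.take_eq_nil_iff, not_or]
          refine ⟨by omega, ?_⟩
          rintro rfl; simp at hk; omega
        · exact h2 b hb
      · rw [List.flatten_cons, List.append_assoc]
        refine (h3.append_left _).trans ?_
        conv_rhs => rw [hsplit k hk, List.map_append]
        exact List.perm_append_comm_assoc ..
      · simp at h4 ⊢; omega
    · rw [List.filter_cons_of_pos (by simp [h1])] at hE
      obtain ⟨k, rfl⟩ : ∃ k, x = 2 * k + 3 := ⟨(x - 3) / 2, by omega⟩
      obtain ⟨e, E, rfl⟩ := List.exists_cons_of_length_eq_add_one hE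
      have hE' : E.length = (m.filter (fun x => x % 2 = 1)).length := by simpa using hE
      have hodd : 3 * E.length ≤ m.sum := by
        rw [hE']; exact three_mul_odd_le m hm'
      rw [List.length_cons] at hR
      have hk : k ≤ R.length := by omega
      obtain ⟨B, R', h1, h2, h3, h4⟩ := ih hm' E (R.drop k) hE' (by simp; omega)
      refine ⟨([e.1, e.2] :: (R.take k).map fun y => [y]) :: B, R', ?_, ?_, ?_, ?_⟩
      · rw [List.map_cons, h1]
        congr 1
        simp [Function.comp_def]; omega
      · intro b hb
        rcases List.mem_cons.1 hb with rfl | hb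
        · refine ⟨by simp, fun P hP => ?_⟩
          rcases List.mem_cons.1 hP with rfl | hP
          · simp
          · obtain ⟨y, -, rfl⟩ := List.mem_map.1 hP; simp
        · exact h2 b hb
      · rw [List.flatten_cons, List.append_assoc, List.map_cons, List.cons_append, List.cons_append]
        refine List.Perm.cons _ ?_
        refine (h3.append_left _).trans ?_
        conv_rhs => rw [hsplit k hk, List.map_append]
        exact List.perm_append_comm_assoc ..
      · simp at h4 ⊢; omega

end Base
end Oberwolfach

namespace Oberwolfach

open Equiv Equiv.Perm

section Forest

/-- The list of endpoints of a list of pairs. -/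
def ends {α : Type*} (E : List (α × α)) : List α := E.flatMap fun e => [e.1, e.2]

@[simp] theorem length_ends {α : Type*} (E : List (α × α)) : (ends E).length = 2 * E.length := by
  simp [ends]; omega

theorem mem_ends {α : Type*} {E : List (α × α)} {x : α} :
    x ∈ ends E ↔ ∃ e ∈ E, x = e.1 ∨ x = e.2 := by
  simp [ends]

theorem map_ends {α β : Type*} (f : α → β) (E : List (α × α)) :
    (ends E).map f = ends (E.map (Prod.map f f)) := by
  simp [ends, List.map_flatMap, List.flatMap_map]

theorem ends_eq_flatten {α : Type*} (E : List (α × α)) :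
    ends E = (E.map fun e => [e.1, e.2]).flatten := by
  simp [ends, List.flatMap]

theorem nodup_map_natCast {t : ℕ} {l : List ℕ} (h : l.Nodup) (hlt : ∀ x ∈ l, x < t) :
    (l.map (fun x : ℕ => (x : ZMod t))).Nodup := by
  refine List.Nodup.map_on ?_ h
  intro x hx y hy hxy
  rw [ZMod.natCast_eq_natCast_iff', Nat.mod_eq_of_lt (hlt x hx), Nat.mod_eq_of_lt (hlt y hy)] at hxy
  exact hxy

theorem exists_complement {Y : Type*} [Fintype Y] [DecidableEq Y] (l : List Y) (hl : l.Nodup) :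
    ∃ R : List Y, R.length + l.length = Fintype.card Y ∧ ∀ y, y ∈ l ∨ y ∈ R := by
  refine ⟨(Finset.univ \ l.toFinset).toList, ?_, fun y => ?_⟩
  · rw [Finset.length_toList, ← List.toFinset_card_of_nodup hl,
      Finset.card_sdiff_add_card_eq_card (Finset.subset_univ _), Finset.card_univ]
  · by_cases h : y ∈ l <;> simp [h]

theorem flatten_map_singleton {α : Type*} (l : List α) : (l.map fun y => [y]).flatten = l := by
  induction l with
  | nil => rfl
  | cons x l ih => simp [ih]

theorem hasOPSolution_append_singleton_of_forest (m : List ℕ) (h2 : ∀ x ∈ m, 2 ≤ x) (t : ℕ)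
    [NeZero t] (hs : 0 < m.sum) (hsol : HasOPSolution m)
    (E : List (ℕ × ℕ)) (Q : List (List ℕ))
    (hE : E.length = (m.filter (fun x => x % 2 = 1)).length) (hQne : ∀ P ∈ Q, P ≠ [])
    (hQ : 2 * Q.length ≤ m.sum + E.length)
    (hnd : (ends E ++ Q.flatten).Nodup) (hlt : ∀ x ∈ ends E ++ Q.flatten, x < t)
    (hcount : t + Q.length = m.sum + E.length + Q.flatten.length)
    (D : List (ZMod t)) (hD : Factorable {t} t D) (hDl : D.length = m.sum - 1)
    (hcov : ∀ d : ZMod t, d ≠ 0 → d ∈ D ∨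
      ∃ u v : ℕ, ((u, v) ∈ E ∨ ∃ P ∈ Q, [u, v] <:+: P) ∧ (v : ZMod t) = u + d) :
    HasOPSolution (m ++ [t]) := by
  let c : ℕ → ZMod t := fun x => x
  let E' := E.map (Prod.map c c)
  let Q' := Q.map (List.map c)
  have hnd' : (ends E' ++ Q'.flatten).Nodup := by
    have := nodup_map_natCast hnd hlt
    rwa [List.map_append, map_ends, List.map_flatten] at this
  have hQl : Q'.flatten.length = Q.flatten.length := by
    change (List.flatten (List.map (List.map c) Q)).length = _
    rw [← List.map_flatten, List.length_map]
  have hEl : E'.length = E.length := List.length_map _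
  have hQl' : Q'.length = Q.length := List.length_map _
  obtain ⟨R, hR, hRc⟩ := exists_complement _ hnd'
  rw [ZMod.card, List.length_append, length_ends, hQl, hEl] at hR
  have hodd := three_mul_odd_le m h2
  rw [← hE] at hodd
  obtain ⟨B, R', hB1, hB2, hB3, hB4⟩ := exists_blocks m h2 E' R (by rw [hEl, hE]) (by omega)
  let L := Q' ++ R'.map fun y => [y]
  let C := B ++ [L]
  have hBl : B.flatten.length + R'.length = E.length + R.length := by
    have := hB3.length_eq
    simpa [hEl] using this
  have hBf : (B.flatten.flatten ++ R').Perm (ends E' ++ R) := by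
    have := hB3.flatten
    simpa only [List.flatten_append, flatten_map_singleton, ← ends_eq_flatten] using this
  have hBfl := hBf.length_eq
  simp only [List.length_append, length_ends, hEl] at hBfl
  have hCf : C.flatten.flatten = B.flatten.flatten ++ (Q'.flatten ++ R') := by
    simp [C, L, flatten_map_singleton]
  have hLne : L ≠ [] := by
    intro h
    have h1 : L.length = 0 := by rw [h]; rfl
    simp only [L, List.length_append, List.length_map, hQl'] at h1
    have h3 : Q = [] := List.eq_nil_of_length_eq_zero (by omega)
    have h4 : Q.flatten.length = 0 := by rw [h3]; rfl
    omega
  have hB2' : ∀ b ∈ C, b ≠ [] ∧ ∀ P ∈ b, P ≠ [] := by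
    intro b hb
    rcases List.mem_append.1 hb with h | h
    · exact hB2 b h
    · obtain rfl := List.mem_singleton.1 h
      refine ⟨hLne, fun P hP => ?_⟩
      rcases List.mem_append.1 hP with h | h
      · obtain ⟨P, hP', rfl⟩ := List.mem_map.1 h
        simpa using hQne P hP'
      · obtain ⟨y, -, rfl⟩ := List.mem_map.1 h
        simp
  have hpaths : (C.map List.length).sum = m.sum := by
    simp only [C, L, List.map_append, List.sum_append, ← List.length_flatten]
    simp [hQl']
    rw [← List.length_flatten]
    omega
  have hcv : ∀ y, y ∈ C.flatten.flatten ∨ ∃ e ∈ ([] : List (ZMod t × ZMod t)), y = e.1 ∨ y = e.2 := by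
    intro y
    left
    rw [hCf]
    have h1 := hRc y
    have h2 := hBf.mem_iff (a := y)
    simp only [List.mem_append] at h1 h2 ⊢
    tauto
  have hcd : C.flatten.flatten.length + 2 * ([] : List (ZMod t × ZMod t)).length = Fintype.card (ZMod t) := by
    rw [hCf, ZMod.card]
    simp only [List.length_append, hQl, List.length_nil]
    omega
  obtain ⟨β, hβ1, hβ2, hβ3, -⟩ := exists_base hs C [] hB2' hpaths hcv hcd
  refine hasOPSolution_of_base m _ [t] t hs (by simp) rfl hsol D hD hDl β ?_ hβ2 ?_
  · rw [hβ1]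
    simp only [C, L, List.map_append, hB1, List.length_nil, List.replicate_zero, List.append_nil,
      List.map_cons, List.map_nil]
    rw [List.flatten_append, flatten_map_singleton]
    simp only [List.length_append, hQl, hQl', List.length_map]
    congr 3
    omega
  · intro d hd
    rcases hcov d hd with h | ⟨u, v, h, huv⟩
    · exact Or.inl h
    · refine Or.inr ⟨u, ?_⟩
      rw [← huv]
      rcases h with h | ⟨P, hP, h⟩
      · have : [c u, c v] ∈ B.flatten ++ R'.map fun y => [y] := by
          rw [hB3.mem_iff]
          refine List.mem_append_left _ (List.mem_map.2 ⟨(c u, c v), ?_, rfl⟩)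
          exact List.mem_map.2 ⟨_, h, rfl⟩
        rcases List.mem_append.1 this with h | h
        · obtain ⟨b, hb, hP⟩ := List.mem_flatten.1 h
          exact hβ3 b (List.mem_append_left _ hb) _ hP _ _ (List.infix_refl _)
        · simp at h
      · refine hβ3 L (by simp [C]) (P.map c) ?_ _ _ (h.map c)
        exact List.mem_append_left _ (List.mem_map_of_mem hP)


theorem hasOPSolution_append_twos_of_forest (m : List ℕ) (h2 : ∀ x ∈ m, 2 ≤ x) (t : ℕ)
    [NeZero t] (hs : 0 < m.sum) (hsol : HasOPSolution m)
    (E : List (ℕ × ℕ)) (F : List (ℕ × ℕ))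
    (hE : E.length = (m.filter (fun x => x % 2 = 1)).length)
    (hnd : (ends E ++ ends F).Nodup) (hlt : ∀ x ∈ ends E ++ ends F, x < t)
    (hcount : t = m.sum + E.length + 2 * F.length) (hte : Even t)
    (D : List (ZMod t)) (hD : Factorable (List.replicate (t / 2) 2 : List ℕ) t D)
    (hDl : D.length = m.sum - 1)
    (hcov : ∀ d : ZMod t, d ≠ 0 → d ∈ D ∨
      ∃ u v : ℕ, ((u, v) ∈ E ∨ (u, v) ∈ F ∨ (v, u) ∈ F) ∧ (v : ZMod t) = u + d) :
    HasOPSolution (m ++ List.replicate (t / 2) 2) := by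
  let c : ℕ → ZMod t := fun x => x
  let E' := E.map (Prod.map c c)
  let F' := F.map (Prod.map c c)
  have hnd' : (ends E' ++ ends F').Nodup := by
    have := nodup_map_natCast hnd hlt
    rwa [List.map_append, map_ends, map_ends] at this
  have hEl : E'.length = E.length := List.length_map _
  have hFl : F'.length = F.length := List.length_map _
  obtain ⟨R, hR, hRc⟩ := exists_complement _ hnd'
  rw [ZMod.card, List.length_append, length_ends, length_ends, hFl, hEl] at hR
  have hodd := three_mul_odd_le m h2
  rw [← hE] at hodd
  obtain ⟨B, R', hB1, hB2, hB3, hB4⟩ := exists_blocks m h2 E' R (by rw [hEl, hE]) (by omega)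
  let C := B ++ R'.map fun y => [[y]]
  have hBl : B.flatten.length + R'.length = E.length + R.length := by
    have := hB3.length_eq
    simpa [hEl] using this
  have hBf : (B.flatten.flatten ++ R').Perm (ends E' ++ R) := by
    have := hB3.flatten
    simpa only [List.flatten_append, flatten_map_singleton, ← ends_eq_flatten] using this
  have hBfl := hBf.length_eq
  simp only [List.length_append, length_ends, hEl] at hBfl
  have hR'1 : (R'.map fun y => [[y]]).flatten = R'.map fun y => [y] := by
    rw [show (fun y : ZMod t => [[y]]) = (fun x => [x]) ∘ fun y => [y] from rfl, ← List.map_map,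
      flatten_map_singleton]
  have hCf : C.flatten = B.flatten ++ R'.map fun y => [y] := by
    rw [List.flatten_append, hR'1]
  have hCf' : C.flatten.flatten = B.flatten.flatten ++ R' := by
    rw [hCf, List.flatten_append, flatten_map_singleton]
  have hB2' : ∀ b ∈ C, b ≠ [] ∧ ∀ P ∈ b, P ≠ [] := by
    intro b hb
    rcases List.mem_append.1 hb with h | h
    · exact hB2 b h
    · obtain ⟨y, -, rfl⟩ := List.mem_map.1 h
      simp
  have hpaths : (C.map List.length).sum = m.sum := by
    rw [← List.length_flatten, hCf]
    simp only [List.length_append, List.length_map]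
    omega
  have hcv : ∀ y, y ∈ C.flatten.flatten ∨ ∃ e ∈ F', y = e.1 ∨ y = e.2 := by
    intro y
    rw [hCf', ← mem_ends]
    have h1 := hRc y
    have h2 := hBf.mem_iff (a := y)
    simp only [List.mem_append] at h1 h2 ⊢
    tauto
  have hcd : C.flatten.flatten.length + 2 * F'.length = Fintype.card (ZMod t) := by
    rw [hCf', ZMod.card]
    simp only [List.length_append, hFl]
    omega
  obtain ⟨β, hβ1, hβ2, hβ3, hβ4⟩ := exists_base hs C F' hB2' hpaths hcv hcd
  have hdouble : t / 2 * 2 = t := Nat.div_mul_cancel hte.two_dvd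
  refine hasOPSolution_of_base m _ (List.replicate (t / 2) 2) t hs (by simp [hdouble]) rfl hsol
    D hD hDl β ?_ hβ2 ?_
  · rw [hβ1]
    simp only [C, List.map_append, hB1, List.map_map]
    rw [List.append_assoc]
    congr 2
    rw [show List.map ((fun B : List (List (ZMod t)) => B.length + B.flatten.length) ∘
      fun y => [[y]]) R' = List.replicate R'.length 2 from ?_, List.replicate_append_replicate]
    · congr 1; omega
    · rw [← List.map_const']; rfl
  · intro d hd
    rcases hcov d hd with h | ⟨u, v, h, huv⟩
    · exact Or.inl h
    · refine Or.inr ⟨u, ?_⟩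
      rw [← huv]
      rcases h with h | h | h
      · have : [c u, c v] ∈ B.flatten ++ R'.map fun y => [y] := by
          rw [hB3.mem_iff]
          refine List.mem_append_left _ (List.mem_map.2 ⟨(c u, c v), ?_, rfl⟩)
          exact List.mem_map.2 ⟨_, h, rfl⟩
        rw [← hCf] at this
        obtain ⟨b, hb, hP⟩ := List.mem_flatten.1 this
        exact hβ3 b hb _ hP _ _ (List.infix_refl _)
      · exact (hβ4 (c u, c v) (List.mem_map.2 ⟨_, h, rfl⟩)).1
      · exact (hβ4 (c v, c u) (List.mem_map.2 ⟨_, h, rfl⟩)).2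


end Forest
end Oberwolfach

namespace Oberwolfach

open Equiv Equiv.Perm

section Factor

variable {t : ℕ} [NeZero t]

theorem cycleType_of_transitive {α : Type*} [Fintype α] [DecidableEq α] (σ : Perm α) (x : α)
    (h : ∀ y, ∃ n : ℕ, (σ ^ n) x = y) (h2 : 2 ≤ Fintype.card α) :
    σ.cycleType = {Fintype.card α} := by
  have hfix : ∀ y, σ y ≠ y := by
    intro y hy
    have hx : σ x = x := by
      obtain ⟨n, rfl⟩ := h y
      rw [← Perm.mul_apply, ← pow_succ', pow_succ, Perm.mul_apply] at hy
      exact (σ ^ n).injective hy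
    have : ∀ z, z = x := by
      intro z
      obtain ⟨n, rfl⟩ := h z
      exact Perm.pow_apply_eq_self_of_apply_eq_self hx n
    have := Fintype.card_le_one_iff.2 fun a b => (this a).trans (this b).symm
    omega
  have hcyc : σ.IsCycle := by
    refine ⟨x, hfix x, fun y _ => ?_⟩
    obtain ⟨n, hn⟩ := h y
    exact ⟨n, by simpa using hn⟩
  have hsupp : σ.support = Finset.univ := by
    ext y; simp [hfix y]
  rw [hcyc.cycleType, hsupp, Finset.card_univ]

theorem cycleType_of_fixedPointFree_involution {α : Type*} [Fintype α] [DecidableEq α]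
    (σ : Perm α) (h1 : ∀ y, σ (σ y) = y) (h2 : ∀ y, σ y ≠ y) :
    σ.cycleType = (List.replicate (Fintype.card α / 2) 2 : List ℕ) := by
  have hsq : σ ^ 2 = 1 := by
    ext y; simp [pow_two, h1]
  have hall : ∀ n ∈ σ.cycleType, n = 2 := by
    intro n hn
    have hd : n ∣ 2 := (dvd_of_mem_cycleType hn).trans (orderOf_dvd_of_pow_eq_one hsq)
    have := two_le_of_mem_cycleType hn
    have := Nat.le_of_dvd (by norm_num) hd
    omega
  have hrep := Multiset.eq_replicate_of_mem hall
  have hsum : σ.cycleType.sum = Fintype.card α := by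
    rw [sum_cycleType, show σ.support = Finset.univ from ?_, Finset.card_univ]
    ext y; simp [h2 y]
  rw [hrep, ← hsum, hrep]
  simp [Multiset.coe_replicate]

/-- The two cycle types into which Hamiltonian cycles can be factored. -/
def GoodType (T : Multiset ℕ) (t : ℕ) : Prop :=
  T = {t} ∨ Even t ∧ T = (List.replicate (t / 2) 2 : List ℕ)

omit [NeZero t] in
theorem addRight_pow_apply (u y : ZMod t) (n : ℕ) : ((Equiv.addRight u) ^ n) y = y + n * u := by
  induction n with
  | zero => simp
  | succ n ih => rw [pow_succ', Perm.mul_apply, ih]; simp; ring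

theorem cycleType_addRight (ht : 2 ≤ t) {u : ZMod t} (hu : IsUnit u) :
    (Equiv.addRight u : Perm (ZMod t)).cycleType = {t} := by
  have := cycleType_of_transitive (Equiv.addRight u : Perm (ZMod t)) 0 ?_ (by simpa using ht)
  · simpa using this
  · intro y
    obtain ⟨v, hv⟩ := hu.exists_left_inv
    refine ⟨(y * v).val, ?_⟩
    rw [addRight_pow_apply]
    simp [mul_assoc, hv]

/-- A Hamiltonian cycle of even length is a union of two perfect matchings. -/
theorem exists_matchings (ht : 2 ≤ t) (hte : Even t) (σ : Perm (ZMod t))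
    (hσ : σ.cycleType = {t}) :
    ∃ τ₁ τ₂ : Perm (ZMod t), τ₁.cycleType = (List.replicate (t / 2) 2 : List ℕ) ∧
      τ₂.cycleType = (List.replicate (t / 2) 2 : List ℕ) ∧
      ∀ y z, σ y = z ∨ σ z = y → τ₁ y = z ∨ τ₂ y = z := by
  classical
  have hconj : IsConj (Equiv.addRight (1 : ZMod t)) σ := by
    rw [isConj_iff_cycleType_eq, cycleType_addRight ht isUnit_one, hσ]
  obtain ⟨π, hπ⟩ := isConj_iff.1 hconj
  let ε : ZMod t →+* ZMod 2 := ZMod.castHom hte.two_dvd (ZMod 2)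
  have h01 : ∀ x : ZMod 2, (x = 0 ∧ x + 1 ≠ 0 ∧ x - 1 ≠ 0) ∨ (x ≠ 0 ∧ x + 1 = 0 ∧ x - 1 = 0) := by
    decide
  let f : ZMod t → ZMod t := fun y => if ε y = 0 then y + 1 else y - 1
  let g : ZMod t → ZMod t := fun y => if ε y = 0 then y - 1 else y + 1
  have hf : Function.Involutive f := by
    intro y
    rcases h01 (ε y) with ⟨h1, h2, h3⟩ | ⟨h1, h2, h3⟩ <;> simp [f, h1, h3]
  have hg : Function.Involutive g := by
    intro y
    rcases h01 (ε y) with ⟨h1, h2, h3⟩ | ⟨h1, h2, h3⟩ <;> simp [g, h1, h2]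
  have : Fact (1 < t) := ⟨by omega⟩
  have hf' : ∀ y, f y ≠ y := by
    intro y
    rcases h01 (ε y) with ⟨h1, -⟩ | ⟨h1, -⟩ <;> simp [f, h1]
  have hg' : ∀ y, g y ≠ y := by
    intro y
    rcases h01 (ε y) with ⟨h1, -⟩ | ⟨h1, -⟩ <;> simp [g, h1]
  refine ⟨π * hf.toPerm * π⁻¹, π * hg.toPerm * π⁻¹, ?_, ?_, ?_⟩
  · rw [cycleType_conj, cycleType_of_fixedPointFree_involution hf.toPerm hf hf', ZMod.card]
  · rw [cycleType_conj, cycleType_of_fixedPointFree_involution hg.toPerm hg hg', ZMod.card]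
  · intro y z h
    have hπi : ∀ w, π⁻¹ (π w) = w := π.symm_apply_apply
    obtain ⟨y, rfl⟩ := π.surjective y
    obtain ⟨z, rfl⟩ := π.surjective z
    have h' : z = y + 1 ∨ z = y - 1 := by
      rw [← hπ] at h
      simp only [Perm.mul_apply, hπi, Equiv.coe_addRight,
        EmbeddingLike.apply_eq_iff_eq] at h
      rcases h with h | h
      · exact Or.inl h.symm
      · right; rw [← h]; simp
    simp only [Perm.mul_apply, hπi, EmbeddingLike.apply_eq_iff_eq,
      Function.Involutive.coe_toPerm, f, g]
    rcases h' with rfl | rfl <;> split_ifs <;> simp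

theorem factorable_of_hamiltonian {T : Multiset ℕ} (hT : GoodType T t) (ht : 2 ≤ t)
    (l : List (Perm (ZMod t))) (hl : ∀ σ ∈ l, σ.cycleType = {t}) (D : List (ZMod t))
    (hlen : D.length = 2 * l.length)
    (hD : ∀ y, ∀ d ∈ D, ∃ σ ∈ l, σ y = y + d ∨ σ (y + d) = y) : Factorable T t D := by
  have key : ∀ σ : Perm (ZMod t), σ.cycleType = {t} → ∃ τ : Perm (ZMod t) × Perm (ZMod t),
      τ.1.cycleType = T ∧ τ.2.cycleType = T ∧
      ∀ y z, σ y = z ∨ σ z = y → τ.1 y = z ∨ τ.2 y = z := by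
    intro σ hσ
    rcases hT with rfl | ⟨hte, rfl⟩
    · refine ⟨(σ, σ⁻¹), hσ, by rw [cycleType_inv, hσ], ?_⟩
      rintro y z (h | h)
      · exact Or.inl h
      · right; rw [← h]; simp
    · obtain ⟨τ₁, τ₂, h1, h2, h3⟩ := exists_matchings ht hte σ hσ
      exact ⟨(τ₁, τ₂), h1, h2, h3⟩
  choose! τ h1 h2 h3 using key
  refine ⟨l.flatMap fun σ => [(τ σ).1, (τ σ).2], ?_, ?_, ?_⟩
  · rw [hlen]; simp; omega
  · intro ρ hρ
    obtain ⟨σ, hσ, h⟩ := List.mem_flatMap.1 hρ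
    rcases List.mem_cons.1 h with rfl | h
    · exact h1 σ (hl σ hσ)
    · obtain rfl := List.mem_singleton.1 h
      exact h2 σ (hl σ hσ)
  · intro y d hd
    obtain ⟨σ, hσ, h⟩ := hD y d hd
    rcases h3 σ (hl σ hσ) _ _ h with h | h
    · exact ⟨_, List.mem_flatMap.2 ⟨σ, hσ, List.mem_cons_self⟩, h⟩
    · exact ⟨_, List.mem_flatMap.2 ⟨σ, hσ, by simp⟩, h⟩

theorem factorable_unit_pair {T : Multiset ℕ} (hT : GoodType T t) (ht : 2 ≤ t) {u : ZMod t}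
    (hu : IsUnit u) : Factorable T t [u, -u] := by
  refine factorable_of_hamiltonian hT ht [Equiv.addRight u] ?_ _ rfl ?_
  · simpa using cycleType_addRight ht hu
  · simp

theorem factorable_unit (ht : 2 ≤ t) {u : ZMod t} (hu : IsUnit u) : Factorable {t} t [u] :=
  ⟨[Equiv.addRight u], rfl, by simpa using cycleType_addRight ht hu, by simp⟩

theorem factorable_half (h : ℕ) (ht : t = 2 * h) :
    Factorable (List.replicate (t / 2) 2 : List ℕ) t [(h : ZMod t)] := by
  have hh : (h : ZMod t) + h = 0 := by
    have : ((2 * h : ℕ) : ZMod t) = 0 := by rw [← ht]; simp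
    push_cast at this
    rw [← this]; ring
  refine ⟨[Equiv.addRight (h : ZMod t)], rfl, ?_, by simp⟩
  simp only [List.mem_singleton, forall_eq]
  rw [cycleType_of_fixedPointFree_involution, ZMod.card]
  · intro y; simp [add_assoc, hh]
  · intro y
    simp only [Equiv.coe_addRight, ne_eq, add_eq_left]
    rw [ZMod.natCast_eq_zero_iff]
    intro hdvd
    have := NeZero.pos t
    have := Nat.le_of_dvd (by omega) hdvd
    omega

/-- For `t = 2 * h` with `h` odd, alternately adding `1` and `h`. -/
theorem exists_alternating (h : ℕ) (ht : t = 2 * h) (hodd : Odd h) :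
    ∃ σ τ : Perm (ZMod t), σ.cycleType = {t} ∧ τ.cycleType = {t} ∧
      ∀ y, (σ y = y + 1 ∧ τ y = y + h) ∨ (σ y = y + h ∧ τ y = y + 1) := by
  classical
  have hte : 2 ∣ t := ⟨h, ht⟩
  let ε : ZMod t →+* ZMod 2 := ZMod.castHom hte (ZMod 2)
  have h01 : ∀ x : ZMod 2, (x = 0 ∧ x + 1 ≠ 0 ∧ x - 1 ≠ 0) ∨ (x ≠ 0 ∧ x + 1 = 0 ∧ x - 1 = 0) := by
    decide
  have hε : ε (h : ZMod t) = 1 := by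
    rw [map_natCast]
    exact (ZMod.natCast_eq_one_iff_odd).2 hodd
  have hh : (h : ZMod t) + h = 0 := by
    have : ((2 * h : ℕ) : ZMod t) = 0 := by rw [← ht]; simp
    push_cast at this
    rw [← this]; ring
  have build : ∀ a b : ZMod t, ε a = 1 → ε b = 1 → (a + b = 1 + h) →
      ∃ σ : Perm (ZMod t), σ.cycleType = {t} ∧ ∀ y, σ y = if ε y = 0 then y + a else y + b := by
    intro a b ha hb hab
    let σ : Perm (ZMod t) :=
      { toFun := fun y => if ε y = 0 then y + a else y + b
        invFun := fun y => if ε y = 0 then y - b else y - a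
        left_inv := by
          intro y
          rcases h01 (ε y) with ⟨h1, h2, h3⟩ | ⟨h1, h2, h3⟩ <;> simp [h1, h2, ha, hb]
        right_inv := by
          intro y
          rcases h01 (ε y) with ⟨h1, h2, h3⟩ | ⟨h1, h2, h3⟩ <;> simp [h1, h3, ha, hb] }
    have hσ : ∀ y, σ y = if ε y = 0 then y + a else y + b := fun y => rfl
    refine ⟨σ, ?_, hσ⟩
    have hsq : ∀ n : ℕ, (σ ^ (2 * n)) 0 = n * (1 + h) := by
      intro n
      induction n with
      | zero => simp
      | succ n ih =>
        have he : ε (n * (1 + h)) = 0 := by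
          rw [map_mul, map_add, hε, map_one]
          rw [show (1 : ZMod 2) + 1 = 0 from rfl, mul_zero]
        rw [show 2 * (n + 1) = (2 * n + 1) + 1 from rfl, pow_succ', pow_succ', Perm.mul_apply,
          Perm.mul_apply, ih, hσ (_ * _), if_pos he, hσ, if_neg]
        · rw [add_assoc, hab]; push_cast; ring
        · rw [map_add, he, ha]; decide
    have heven : ∀ n : ℕ, (σ ^ (2 * (2 * n))) 0 = 2 * n := by
      intro n
      rw [hsq]
      push_cast
      linear_combination (n : ZMod t) * hh
    have h2t : 2 ≤ t := by have := hodd.pos; omega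
    have := cycleType_of_transitive σ 0 ?_ (by simpa using h2t)
    · simpa using this
    · have hev : ∀ y, ε y = 0 → ∃ n : ℕ, (σ ^ n) 0 = y := by
        intro y hy
        have hy' : ((y.val : ℕ) : ZMod 2) = 0 := by
          rw [← map_natCast ε, ZMod.natCast_zmod_val, hy]
        obtain ⟨k, hk⟩ := (ZMod.natCast_eq_zero_iff _ _).1 hy'
        refine ⟨2 * (2 * k), ?_⟩
        rw [heven, ← ZMod.natCast_zmod_val y, hk]; push_cast; rfl
      intro y
      by_cases hy : ε y = 0
      · exact hev y hy
      · have : ε (y - a) = 0 := by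
          rw [map_sub, ha]
          rcases h01 (ε y) with ⟨h1, -⟩ | ⟨-, -, h3⟩
          · exact absurd h1 hy
          · exact h3
        obtain ⟨n, hn⟩ := hev _ this
        refine ⟨n + 1, ?_⟩
        rw [pow_succ', Perm.mul_apply, hn, hσ, if_pos this]; simp
  obtain ⟨σ, h1, h2⟩ := build 1 h (map_one ε) hε rfl
  obtain ⟨τ, h3, h4⟩ := build h 1 hε (map_one ε) (add_comm _ _)
  refine ⟨σ, τ, h1, h3, fun y => ?_⟩
  rw [h2, h4]
  split_ifs <;> simp

theorem factorable_one_neg_one_half (h : ℕ) (ht : t = 2 * h) (hodd : Odd h) :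
    Factorable {t} t [1, -1, (h : ZMod t)] := by
  obtain ⟨σ, τ, h1, h2, h3⟩ := exists_alternating h ht hodd
  have h2t : 2 ≤ t := by have := hodd.pos; omega
  refine ⟨[σ, τ, Equiv.addRight (-1)], rfl, ?_, ?_⟩
  · simp [h1, h2, cycleType_addRight h2t isUnit_one.neg]
  · intro y d hd
    simp only [List.mem_cons, List.not_mem_nil, or_false] at hd
    rcases hd with rfl | rfl | rfl
    · rcases h3 y with h | h <;> simp [h]
    · simp
    · rcases h3 y with h | h <;> simp [h]

end Factor
end Oberwolfach

namespace Oberwolfach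

open Equiv Equiv.Perm

section Hamilton

theorem exists_hamiltonian {V : Type*} [Fintype V] [DecidableEq V] (G : SimpleGraph V)
    (hG : G.Connected) (h2 : ∀ v, (G.neighborSet v).ncard = 2) :
    ∃ σ : Perm V, σ.cycleType = {Fintype.card V} ∧ ∀ u v, G.Adj u v → σ u = v ∨ σ v = u := by
  obtain ⟨v⟩ := hG.nonempty
  have hcyc : G.IsCycles := fun v _ => h2 v
  obtain ⟨p, hp, hverts⟩ := hcyc.exists_cycle_toSubgraph_verts_eq_connectedComponentSupp
    (c := G.connectedComponentMk v) (v := v) rfl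
    (by rw [← Set.ncard_pos, h2]; norm_num)
  let xs := p.support.tail
  have hnd : xs.Nodup := hp.support_nodup
  have hlen : xs.length = p.length := by simp [xs]
  have h3 := hp.three_le_length
  have hmem : ∀ w, w ∈ xs := by
    intro w
    have h1 : w ∈ p.toSubgraph.verts := by
      rw [hverts]
      exact SimpleGraph.ConnectedComponent.sound (hG.preconnected w v)
    rw [SimpleGraph.Walk.mem_verts_toSubgraph] at h1
    rcases (SimpleGraph.Walk.mem_support_iff p).1 h1 with rfl | h
    · exact SimpleGraph.Walk.end_mem_tail_support hp.not_nil
    · exact h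
  have hget : ∀ i (hi : i < xs.length), xs[i] = p.getVert (i + 1) := by
    intro i hi
    simp only [xs, List.getElem_tail]
    rw [SimpleGraph.Walk.getVert_eq_support_getElem _ (by omega)]
  let σ := xs.formPerm
  have hσ : ∀ i (hi : i < xs.length), σ xs[i] = xs[(i + 1) % xs.length]'(Nat.mod_lt _ (by omega)) :=
    fun i hi => List.formPerm_apply_getElem xs hnd i hi
  have hadj : ∀ u, G.Adj u (σ u) := by
    intro u
    obtain ⟨i, hi, rfl⟩ := List.getElem_of_mem (hmem u)
    rw [hσ, hget, hget]
    by_cases h : i + 1 < xs.length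
    · simp only [Nat.mod_eq_of_lt h]
      exact p.adj_getVert_succ (by omega)
    · have h' : i + 1 = xs.length := by omega
      simp only [h', Nat.mod_self]
      rw [hlen, SimpleGraph.Walk.getVert_length]
      have := p.adj_getVert_succ (i := 0) (by omega)
      simpa using this
  have hne : ∀ u, σ (σ u) ≠ u := by
    intro u
    obtain ⟨i, hi, rfl⟩ := List.getElem_of_mem (hmem u)
    rw [hσ, hσ, Ne, hnd.getElem_inj_iff, Nat.mod_add_mod]
    intro h
    by_cases h' : i + 1 + 1 < xs.length
    · rw [Nat.mod_eq_of_lt h'] at h; omega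
    · rw [Nat.mod_eq_sub_mod (by omega), Nat.mod_eq_of_lt (by omega)] at h; omega
  refine ⟨σ, ?_, ?_⟩
  · have hcyc : σ.IsCycle := List.isCycle_formPerm hnd (by omega)
    rw [hcyc.cycleType, List.support_formPerm_of_nodup _ hnd]
    · rw [show xs.toFinset = Finset.univ by ext; simp [hmem], Finset.card_univ]
    · intro x hx
      have : xs.length = 1 := by rw [hx]; rfl
      omega
  · intro u w huw
    by_contra hcon
    push Not at hcon
    have hinv : σ (σ⁻¹ u) = u := σ.apply_symm_apply u
    have hsub : ({σ u, σ⁻¹ u, w} : Set V) ⊆ G.neighborSet u := by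
      rintro x (rfl | rfl | rfl)
      · exact hadj u
      · have := hadj (σ⁻¹ u)
        rw [hinv] at this
        exact this.symm
      · exact huw
    have hcard : ({σ u, σ⁻¹ u, w} : Set V).ncard = 3 := by
      rw [Set.ncard_eq_three]
      refine ⟨_, _, _, ?_, hcon.1, ?_, rfl⟩
      · intro h
        apply hne (σ⁻¹ u)
        rw [hinv, h]
      · rintro rfl
        exact hcon.2 hinv
    have := Set.ncard_le_ncard hsub
    rw [hcard, h2] at this
    omega

end Hamilton
end Oberwolfach

namespace Oberwolfach

section Switching

variable {G : Type*} [AddCommGroup G] [Finite G] {R : Setoid G} {A : Set G} {a b : G}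

omit [Finite G] in
/-- Walking in direction `a` while avoiding `A`. -/
theorem rel_walk (hR : ∀ y, y ∉ A → R y (y + a)) (y : G) {i k : ℕ} (hik : i ≤ k)
    (h : ∀ j, i ≤ j → j < k → y + j • a ∉ A) : R (y + i • a) (y + k • a) := by
  induction k, hik using Nat.le_induction with
  | base => exact R.refl _
  | succ k hik ih =>
    refine R.trans (ih fun j h1 h2 => h j h1 (by omega)) ?_
    rw [succ_nsmul, ← add_assoc]
    exact hR _ (h k hik (by omega))

theorem exists_nsmul_lt {y z : G} (h : ∃ n : ℕ, z = y + n • a) :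
    ∃ n < addOrderOf a, z = y + n • a := by
  obtain ⟨n, rfl⟩ := h
  exact ⟨n % addOrderOf a, Nat.mod_lt _ (addOrderOf_pos a), by rw [mod_addOrderOf_nsmul]⟩

/-- In a column meeting `A` in at most `p` and `q`, every vertex is joined to `p` or to `p + a`. -/
theorem rel_of_column (hR : ∀ y, y ∉ A → R y (y + a)) {p q y : G}
    (hp : ∃ n : ℕ, p = y + n • a) (hq : ∃ n : ℕ, q = y + n • a)
    (hA : ∀ n : ℕ, y + n • a ∈ A → y + n • a = p ∨ y + n • a = q) :
    R y p ∨ R y (p + a) := by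
  obtain ⟨i, hi, rfl⟩ := exists_nsmul_lt hp
  obtain ⟨j, hj, rfl⟩ := exists_nsmul_lt hq
  have hinj : ∀ k l, k < addOrderOf a → l < addOrderOf a → y + k • a = y + l • a → k = l := by
    intro k l hk hl h
    exact nsmul_injOn_Iio_addOrderOf hk hl (add_left_cancel h)
  rcases le_or_gt i j with hij | hij
  · left
    have := rel_walk hR y (Nat.zero_le i) fun k _ hk hkA => by
      rcases hA k hkA with h | h
      · have := hinj _ _ (by omega) hi h; omega
      · have := hinj _ _ (by omega) hj h; omega
    simpa using this
  · right
    have := rel_walk hR y (i := i + 1) (k := addOrderOf a) hi fun k hk1 hk2 hkA => by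
      rcases hA k hkA with h | h
      · have := hinj _ _ hk2 hi h; omega
      · have := hinj _ _ hk2 hj h; omega
    rw [addOrderOf_nsmul_eq_zero, add_zero, succ_nsmul, ← add_assoc] at this
    exact R.symm this

/-- In a column meeting `A` in at most `p ≠ q`, the vertices `q + a` and `p` are joined. -/
theorem rel_of_column_of_ne (hR : ∀ y, y ∉ A → R y (y + a)) {p q : G}
    (hp : ∃ n : ℕ, p = q + n • a) (hpq : p ≠ q)
    (hA : ∀ n : ℕ, q + n • a ∈ A → q + n • a = p ∨ q + n • a = q) :
    R (q + a) p := by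
  obtain ⟨i, hi, rfl⟩ := exists_nsmul_lt hp
  have hi0 : i ≠ 0 := by rintro rfl; simp at hpq
  have hinj : ∀ k l, k < addOrderOf a → l < addOrderOf a → q + k • a = q + l • a → k = l := by
    intro k l hk hl h
    exact nsmul_injOn_Iio_addOrderOf hk hl (add_left_cancel h)
  have := rel_walk hR q (i := 1) (k := i) (by omega) fun k hk1 hk2 hkA => by
    rcases hA k hkA with h | h
    · have := hinj _ _ (by omega) hi h; omega
    · have := hinj k 0 (by omega) (by omega) (by simpa using h); omega
  simpa using this

/-- Connectivity criterion for a switched Cayley graph: all `a`-edges outside `A` together with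
the `b`-edges at `s i` and `s i + a`. -/
theorem rel_total (g : ℕ) [NeZero g] (π : G →+ ZMod g) (ha : π a = 0) (hb : π b = 1)
    (hker : ∀ y, π y = 0 → ∃ n : ℕ, y = n • a) (M : ℕ) (s : ℕ → G)
    (hs : ∀ i < M, π (s i) = i)
    (hA : ∀ y ∈ A, ∃ i < M, y = s i ∨ y = s i + b)
    (hR : ∀ y, y ∉ A → R y (y + a))
    (hRb : ∀ i < M, R (s i) (s i + b)) (hRb' : ∀ i < M, R (s i + a) (s i + a + b))
    (hM0 : 0 < M)
    (hM : M + 1 = g ∨ (M = g ∧ Odd g ∧ (∀ i, i + 1 < M → s i + b ≠ s (i + 1)) ∧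
      s (g - 1) + b ≠ s 0)) (x y : G) : R x y := by
  have hcol : ∀ {y z : G}, π y = π z → ∃ n : ℕ, z = y + n • a := by
    intro y z h
    obtain ⟨n, hn⟩ := hker (z - y) (by rw [map_sub, h, sub_self])
    exact ⟨n, by rw [← hn]; abel⟩
  have hπn : ∀ (y : G) (n : ℕ), π (y + n • a) = π y := by
    intro y n; simp [ha]
  have hcast : ∀ i j : ℕ, i < g → j < g → (i : ZMod g) = j → i = j := by
    intro i j hi hj h
    rwa [ZMod.natCast_eq_natCast_iff', Nat.mod_eq_of_lt hi, Nat.mod_eq_of_lt hj] at h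
  have hMg : M ≤ g := by omega
  -- elements of `A` in column `i + 1`
  have hAcol : ∀ i, i < M → i + 1 < g → ∀ z ∈ A, π z = ((i + 1 : ℕ) : ZMod g) →
      z = s i + b ∨ (i + 1 < M ∧ z = s (i + 1)) := by
    intro i hi hig z hz hπz
    obtain ⟨j, hj, rfl | rfl⟩ := hA z hz
    · rw [hs j hj] at hπz
      obtain rfl := hcast _ _ (by omega) hig hπz
      exact Or.inr ⟨hj, rfl⟩
    · rw [map_add, hs j hj, hb] at hπz
      left
      have : i = j := by
        have h' : ((j + 1 : ℕ) : ZMod g) = ((i + 1 : ℕ) : ZMod g) := by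
          rw [← hπz]; push_cast; rfl
        push_cast at h'
        exact (hcast _ _ (by omega) (by omega) (add_right_cancel h')).symm
      rw [this]
  have hstep : ∀ i, i < M → i + 1 < g → ∀ y, π y = ((i + 1 : ℕ) : ZMod g) →
      ∃ z, π z = (i : ZMod g) ∧ R y z := by
    intro i hi hig y hy
    have hp : π (s i + b) = π y := by rw [map_add, hs i hi, hb, hy]; push_cast; rfl
    obtain ⟨q, hq, hq'⟩ : ∃ q, π q = π y ∧ ∀ n : ℕ, y + n • a ∈ A →
        y + n • a = s i + b ∨ y + n • a = q := by
      by_cases h : i + 1 < M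
      · refine ⟨s (i + 1), by rw [hs _ h, hy], fun n hn => ?_⟩
        rcases hAcol i hi hig _ hn (by rw [hπn, hy]) with h | h
        · exact Or.inl h
        · exact Or.inr h.2
      · refine ⟨s i + b, hp, fun n hn => ?_⟩
        rcases hAcol i hi hig _ hn (by rw [hπn, hy]) with h' | h'
        · exact Or.inl h'
        · exact absurd h'.1 h
    rcases rel_of_column hR (hcol hp.symm) (hcol hq.symm) hq' with h | h
    · exact ⟨s i, hs i hi, R.trans h (R.symm (hRb i hi))⟩
    · refine ⟨s i + a, by rw [map_add, hs i hi, ha, add_zero], R.trans h ?_⟩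
      rw [add_right_comm]
      exact R.symm (hRb' i hi)
  have hzero : ∀ i, i < g → ∀ y, π y = (i : ZMod g) → ∃ z, π z = 0 ∧ R y z := by
    intro i
    induction i with
    | zero => exact fun _ y hy => ⟨y, by simpa using hy, R.refl y⟩
    | succ i ih =>
      intro hi y hy
      obtain ⟨z, hz, hyz⟩ := hstep i (by omega) hi y hy
      obtain ⟨w, hw, hzw⟩ := ih (by omega) z hz
      exact ⟨w, hw, R.trans hyz hzw⟩
  have hzero' : ∀ y, ∃ z, π z = 0 ∧ R y z := fun y =>
    hzero (π y).val (ZMod.val_lt _) y (by simp)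
  have hs0 : π (s 0) = 0 := by simpa using hs 0 hM0
  suffices h0 : ∀ z, π z = 0 → R z (s 0) by
    obtain ⟨z, hz, hxz⟩ := hzero' x
    obtain ⟨w, hw, hyw⟩ := hzero' y
    exact R.trans (R.trans hxz (h0 z hz)) (R.symm (R.trans hyw (h0 w hw)))
  rcases hM with hM | ⟨rfl, hodd, hne, hwrap⟩
  · -- column `0` meets `A` only in `s 0`
    have hA0 : ∀ z ∈ A, π z = 0 → z = s 0 := by
      intro z hz hπz
      obtain ⟨j, hj, rfl | rfl⟩ := hA z hz
      · rw [hs j hj] at hπz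
        rw [hcast j 0 (by omega) (by omega) (by simpa using hπz)]
      · rw [map_add, hs j hj, hb] at hπz
        have := hcast (j + 1) 0 (by omega) (by omega) (by simpa using hπz)
        omega
    intro z hz
    obtain ⟨n, hn⟩ := exists_nsmul_lt (hcol (hz.trans hs0.symm))
    have hex : ∃ n : ℕ, z + n • a = s 0 := ⟨n, hn.2.symm⟩
    classical
    have := rel_walk hR z (Nat.zero_le (Nat.find hex)) fun k _ hk hkA =>
      Nat.find_min hex hk (hA0 _ hkA (by rw [hπn, hz]))
    rw [Nat.find_spec hex] at this
    simpa using this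
  · -- columns are cyclically linked
    let g := M
    have hlast : π (s (M - 1) + b) = 0 := by
      rw [map_add, hs _ (by omega), hb]
      have : ((M - 1 + 1 : ℕ) : ZMod M) = 0 := by rw [Nat.sub_add_cancel hM0]; simp
      simpa using this
    have hA0 : ∀ z ∈ A, π z = 0 → z = s (M - 1) + b ∨ z = s 0 := by
      intro z hz hπz
      obtain ⟨j, hj, rfl | rfl⟩ := hA z hz
      · rw [hs j hj] at hπz
        right
        rw [hcast j 0 (by omega) (by omega) (by simpa using hπz)]
      · left
        by_cases h : j + 1 < M
        · rw [map_add, hs j hj, hb] at hπz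
          have := hcast (j + 1) 0 h (by omega) (by simpa using hπz)
          omega
        · rw [show j = M - 1 by omega]
    -- linking two consecutive switches
    have link : ∀ u v, u ∈ Set.range s → (∀ z ∈ A, π z = π v → z = u + b ∨ z = v) →
        π (u + b) = π v → u + b ≠ v → R u (u + b) → R (u + a) (u + a + b) →
        R (v + a) u ∧ R v (u + a) := by
      intro u v _ hcolA hπ huv h1 h2
      refine ⟨R.trans (rel_of_column_of_ne hR (hcol hπ.symm) huv ?_) (R.symm h1), ?_⟩
      · exact fun n hn => hcolA _ hn (hπn _ _)
      · refine R.trans (R.symm (rel_of_column_of_ne hR (hcol hπ) huv.symm ?_)) ?_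
        · exact fun n hn => (hcolA _ hn ((hπn _ _).trans hπ)).symm
        · rw [add_right_comm]; exact R.symm h2
    have hlink : ∀ i, i + 1 < M → R (s (i + 1) + a) (s i) ∧ R (s (i + 1)) (s i + a) := by
      intro i hi
      refine link _ _ ⟨i, rfl⟩ ?_ ?_ (hne i hi) (hRb i (by omega)) (hRb' i (by omega))
      · intro z hz hπ
        rw [hs _ hi] at hπ
        rcases hAcol i (by omega) hi z hz hπ with h | h
        · exact Or.inl h
        · exact Or.inr h.2
      · rw [map_add, hs i (by omega), hs _ hi, hb]; push_cast; rfl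
    have hlink0 : R (s 0 + a) (s (M - 1)) ∧ R (s 0) (s (M - 1) + a) := by
      refine link _ _ ⟨M - 1, rfl⟩ ?_ (hlast.trans hs0.symm) hwrap (hRb _ (by omega))
        (hRb' _ (by omega))
      intro z hz hπ
      exact hA0 z hz (hπ.trans hs0)
    have heven : ∀ k, 2 * k < M → R (s (2 * k)) (s 0) := by
      intro k
      induction k with
      | zero => exact fun _ => R.refl _
      | succ k ih =>
        intro hk
        have h1 := (hlink (2 * k) (by omega)).1
        have h2 := (hlink (2 * k + 1) (by omega)).2
        exact R.trans h2 (R.trans h1 (ih (by omega)))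
    have hs0a : R (s 0 + a) (s 0) := by
      obtain ⟨k, hk⟩ := hodd
      refine R.trans hlink0.1 ?_
      rw [show M - 1 = 2 * k by omega]
      exact heven k (by omega)
    intro z hz
    rcases rel_of_column hR (p := s 0) (q := s (M - 1) + b) (hcol (hz.trans hs0.symm))
      (hcol (hz.trans hlast.symm)) (fun n hn => (hA0 _ hn (by rw [hπn, hz])).symm) with h | h
    · exact h
    · exact R.trans h hs0a

end Switching
end Oberwolfach

namespace Oberwolfach
open Equiv Equiv.Perm

section Switching

variable {G : Type*} [AddCommGroup G] {a b : G}

/-- The set of the first `M` terms of `s` and of their translates by `d`. -/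
def switchSet (s : ℕ → G) (d : G) (M : ℕ) : Set G := {y | ∃ i < M, y = s i ∨ y = s i + d}

theorem switchSet_mono (s : ℕ → G) (d : G) {M N : ℕ} (h : M ≤ N) :
    switchSet s d M ⊆ switchSet s d N :=
  fun _ ⟨i, hi, hy⟩ => ⟨i, by omega, hy⟩

theorem natCast_ne_natCast {g i j : ℕ} (hi : i < g) (hj : j < g) (hij : i ≠ j) :
    (i : ZMod g) ≠ j := by
  intro h
  rw [ZMod.natCast_eq_natCast_iff'] at h
  rw [Nat.mod_eq_of_lt hi, Nat.mod_eq_of_lt hj] at h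
  exact hij h

/-- Extending the switching sequence by two terms preserves connectivity of the second colour. -/
theorem total_switch_step (g : ℕ) (π : G →+ ZMod g) (ha : π a = 0) (hb : π b = 1)
    (ha2 : a + a ≠ 0) (s : ℕ → G) (hs : ∀ i, π (s i) = i) (N : ℕ) (hN : N + 3 ≤ g)
    (h1 : s (N + 1) = s N + a + b) (h2 : s (N + 2) = s N + b + b)
    (ih : ∀ R : Setoid G, (∀ y, y ∉ switchSet s a (N + 1) → R y (y + b)) →
      (∀ y ∈ switchSet s b (N + 1), R y (y + a)) → ∀ x y, R x y)
    (R : Setoid G) (hRb : ∀ y, y ∉ switchSet s a (N + 3) → R y (y + b))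
    (hRa : ∀ y ∈ switchSet s b (N + 3), R y (y + a)) (u v : G) : R u v := by
  classical
  have ha0 : a ≠ 0 := by rintro rfl; simp at ha2
  generalize hx : s N = x at h1 h2
  have hπx : π x = N := by rw [← hx, hs]
  have hπN : (N : ZMod g) + 1 = ((N + 1 : ℕ) : ZMod g) := by push_cast; ring
  have hπN2 : ((N + 1 : ℕ) : ZMod g) + 1 = ((N + 2 : ℕ) : ZMod g) := by push_cast; ring
  let F : Set G := {x + b, x + b + b, x + a + b, x + a + b + b}
  have hF : ∀ y, y ∈ F ↔ y = x + b ∨ y = x + b + b ∨ y = x + a + b ∨ y = x + a + b + b :=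
    fun y => Iff.rfl
  have hπF : ∀ y ∈ F, π y = ((N + 1 : ℕ) : ZMod g) ∨ π y = ((N + 2 : ℕ) : ZMod g) := by
    intro y hy
    rcases (hF y).1 hy with rfl | rfl | rfl | rfl <;>
      simp only [map_add, ha, hb, hπx, add_zero, hπN, hπN2, true_or, or_true]
  -- membership in the larger sets
  have mA0 : x + b ∈ switchSet s b (N + 3) := ⟨N, by omega, by rw [hx]; simp⟩
  have mA1 : x + a + b ∈ switchSet s b (N + 3) := ⟨N + 1, by omega, by rw [h1]; simp⟩
  have mA2 : x + a + b + b ∈ switchSet s b (N + 3) := ⟨N + 1, by omega, by rw [h1]; simp⟩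
  have mA3 : x + b + b ∈ switchSet s b (N + 3) := ⟨N + 2, by omega, by rw [h2]; simp⟩
  have mA4 : x + b + b + b ∈ switchSet s b (N + 3) := ⟨N + 2, by omega, by rw [h2]; simp⟩
  have mB : x + b ∉ switchSet s a (N + 3) := by
    rintro ⟨i, hi, h⟩
    have hπ : π (x + b) = i := by
      rcases h with h | h <;> rw [h] <;> simp [hs, ha]
    rw [map_add, hπx, hb, hπN] at hπ
    have hiN : i = N + 1 := by
      by_contra hne
      exact natCast_ne_natCast (by omega) (by omega) hne hπ.symm
    subst hiN
    rw [h1] at h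
    rcases h with h | h
    · apply ha0
      calc a = (x + a + b) - (x + b) := by abel
        _ = 0 := by rw [← h, sub_self]
    · apply ha2
      calc a + a = (x + a + b + a) - (x + b) := by abel
        _ = 0 := by rw [← h, sub_self]
  -- the path through the switched vertices
  have p1 : R (x + b) (x + a + b) := by
    have := hRa _ mA0; rwa [add_right_comm] at this
  have p2 : R (x + a + b) (x + a + a + b) := by
    have := hRa _ mA1
    rwa [show x + a + b + a = x + a + a + b by abel] at this
  have p3 : R (x + b) (x + b + b) := hRb _ mB
  have p4 : R (x + b + b) (x + a + b + b) := by
    have := hRa _ mA3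
    rwa [show x + b + b + a = x + a + b + b by abel] at this
  have p5 : R (x + a + b + b) (x + a + a + b + b) := by
    have := hRa _ mA2
    rwa [show x + a + b + b + a = x + a + a + b + b by abel] at this
  have p6 : R (x + a + a + b) (x + a + a + b + b) :=
    R.trans (R.symm (R.trans p1 p2)) (R.trans p3 (R.trans p4 p5))
  let f : G → G := fun y => if y ∈ F then x + b + b + b else y
  have fF : ∀ y ∈ F, f y = x + b + b + b := fun y hy => if_pos hy
  have fN : ∀ y, y ∉ F → f y = y := fun y hy => if_neg hy
  have f3 : f (x + b + b + b) = x + b + b + b := by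
    by_cases h : x + b + b + b ∈ F
    · exact fF _ h
    · exact fN _ h
  have key : ∀ u v, R (f u) (f v) := by
    refine ih (R.comap f) ?_ ?_
    · intro y hy
      change R (f y) (f (y + b))
      by_cases hyF : y ∈ F
      · rw [fF y hyF]
        rcases (hF y).1 hyF with rfl | rfl | rfl | rfl
        · rw [fF _ ((hF _).2 (by simp))]
        · rw [f3]
        · rw [fF _ ((hF _).2 (by simp))]
        · by_cases h : x + a + b + b + b ∈ F
          · rw [fF _ h]
          · rw [fN _ h]
            have := hRa _ mA4
            rwa [show x + b + b + b + a = x + a + b + b + b by abel] at this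
      · rw [fN y hyF]
        by_cases hyb : y + b ∈ F
        · exfalso
          rcases (hF _).1 hyb with h | h | h | h
          · exact hy ⟨N, by omega, Or.inl (by rw [hx]; exact add_right_cancel h)⟩
          · exact hyF ((hF _).2 (Or.inl (add_right_cancel h)))
          · exact hy ⟨N, by omega, Or.inr (by rw [hx]; exact add_right_cancel h)⟩
          · exact hyF ((hF _).2 (Or.inr (Or.inr (Or.inl (add_right_cancel h)))))
        · rw [fN _ hyb]
          by_cases hyB : y ∈ switchSet s a (N + 3)
          · obtain ⟨i, hi, h⟩ := hyB
            have hi1 : N + 1 ≤ i := by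
              by_contra hlt
              exact hy ⟨i, by omega, h⟩
            rcases (by omega : i = N + 1 ∨ i = N + 2) with rfl | rfl
            · rw [h1] at h
              rcases h with rfl | rfl
              · exact absurd ((hF _).2 (by simp)) hyF
              · rw [show x + a + b + a = x + a + a + b by abel]
                exact p6
            · rw [h2] at h
              rcases h with rfl | rfl
              · exact absurd ((hF _).2 (by simp)) hyF
              · exact absurd ((hF _).2 (Or.inr (Or.inr (Or.inr (by abel))))) hyF
          · exact hRb _ hyB
    · intro y hy
      change R (f y) (f (y + a))
      by_cases hyx : y = x + b
      · subst hyx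
        rw [fF _ ((hF _).2 (by simp)), fF _ ((hF _).2 (Or.inr (Or.inr (Or.inl (by abel)))))]
      · have hnot : ¬ (π y = ((N + 1 : ℕ) : ZMod g) ∨ π y = ((N + 2 : ℕ) : ZMod g)) := by
          obtain ⟨i, hi, rfl | rfl⟩ := hy
          · rw [hs]
            rintro (h | h)
            · exact natCast_ne_natCast (by omega) (by omega) (by omega) h
            · exact natCast_ne_natCast (by omega) (by omega) (by omega) h
          · have hiN : i ≠ N := by rintro rfl; exact hyx (by rw [hx])
            rw [map_add, hs, hb, show (i : ZMod g) + 1 = ((i + 1 : ℕ) : ZMod g) by push_cast; ring]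
            rintro (h | h)
            · exact natCast_ne_natCast (by omega) (by omega) (by omega) h
            · exact natCast_ne_natCast (by omega) (by omega) (by omega) h
        rw [fN y fun h => hnot (hπF y h), fN (y + a) fun h => hnot (by
          have := hπF _ h
          rwa [map_add, ha, add_zero] at this)]
        exact hRa y (switchSet_mono s b (by omega) hy)
  have hq : x + a + a + b ∉ F := by
    intro h
    rcases (hF _).1 h with h | h | h | h
    · apply ha2
      calc a + a = (x + a + a + b) - (x + b) := by abel
        _ = 0 := by rw [h, sub_self]
    · have := congrArg π h
      simp only [map_add, ha, hb, hπx, add_zero] at this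
      rw [hπN, hπN2] at this
      exact natCast_ne_natCast (by omega) (by omega) (by omega) this
    · exact ha0 (by simpa using add_right_cancel h)
    · have := congrArg π h
      simp only [map_add, ha, hb, hπx, add_zero] at this
      rw [hπN, hπN2] at this
      exact natCast_ne_natCast (by omega) (by omega) (by omega) this
  have p7 : R (x + a + a + b) (x + b + b + b) := by
    have := key (x + a + a + b) (x + b)
    rwa [fN _ hq, fF _ ((hF _).2 (by simp))] at this
  have hfu : ∀ u, R u (f u) := by
    intro u
    by_cases hu : u ∈ F
    · rw [fF u hu]
      refine R.trans ?_ p7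
      rcases (hF _).1 hu with rfl | rfl | rfl | rfl
      · exact R.trans p1 p2
      · exact R.trans (R.symm p3) (R.trans p1 p2)
      · exact p2
      · exact R.trans (R.symm p4) (R.trans (R.symm p3) (R.trans p1 p2))
    · rw [fN u hu]
  exact R.trans (hfu u) (R.trans (key u v) (R.symm (hfu v)))

end Switching
end Oberwolfach

namespace Oberwolfach
open Equiv Equiv.Perm

section Switching

variable {G : Type*} [AddCommGroup G] {a b : G}

/-- The graph formed by the `a`-edges outside `A` and the `b`-edges in `B`. -/
def switchGraph (a b : G) (A B : Set G) : SimpleGraph G :=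
  SimpleGraph.fromRel fun u v => (u ∉ A ∧ v = u + a) ∨ (u ∈ B ∧ v = u + b)

open Classical in
theorem ncard_neighborSet_switchGraph {A B : Set G} (ha : a ≠ 0) (hb : b ≠ 0) (ha2 : a + a ≠ 0)
    (hb2 : b + b ≠ 0) (hab : a ≠ b) (hab' : a + b ≠ 0)
    (h : ∀ y, (if y ∈ A then 1 else 0) + (if y - a ∈ A then 1 else 0) =
      (if y ∈ B then 1 else 0) + (if y - b ∈ B then 1 else 0)) (y : G) :
    ((switchGraph a b A B).neighborSet y).ncard = 2 := by
  have key : (switchGraph a b A B).neighborSet y = {z | (y ∉ A ∧ z = y + a) ∨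
      (y - a ∉ A ∧ z = y - a) ∨ (y ∈ B ∧ z = y + b) ∨ (y - b ∈ B ∧ z = y - b)} := by
    ext z
    rw [SimpleGraph.mem_neighborSet, switchGraph, SimpleGraph.fromRel_adj, Set.mem_ofPred_eq]
    constructor
    · rintro ⟨-, (⟨h1, h2⟩ | ⟨h1, h2⟩) | (⟨h1, h2⟩ | ⟨h1, h2⟩)⟩
      · exact Or.inl ⟨h1, h2⟩
      · exact Or.inr (Or.inr (Or.inl ⟨h1, h2⟩))
      · obtain rfl : z = y - a := by rw [h2]; abel
        exact Or.inr (Or.inl ⟨h1, rfl⟩)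
      · obtain rfl : z = y - b := by rw [h2]; abel
        exact Or.inr (Or.inr (Or.inr ⟨h1, rfl⟩))
    · rintro (⟨h1, rfl⟩ | ⟨h1, rfl⟩ | ⟨h1, rfl⟩ | ⟨h1, rfl⟩)
      · exact ⟨by simpa using ha, Or.inl (Or.inl ⟨h1, rfl⟩)⟩
      · exact ⟨by rwa [ne_eq, eq_comm, sub_eq_self], Or.inr (Or.inl ⟨h1, by abel⟩)⟩
      · exact ⟨by simpa using hb, Or.inl (Or.inr ⟨h1, rfl⟩)⟩
      · exact ⟨by rwa [ne_eq, eq_comm, sub_eq_self], Or.inr (Or.inr ⟨h1, by abel⟩)⟩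
  have e1 : y + a ≠ y - a := fun e => ha2 (by
    calc a + a = (y + a) - (y - a) := by abel
      _ = 0 := by rw [e, sub_self])
  have e2 : y + b ≠ y - b := fun e => hb2 (by
    calc b + b = (y + b) - (y - b) := by abel
      _ = 0 := by rw [e, sub_self])
  have e3 : y + a ≠ y + b := fun e => hab (add_left_cancel e)
  have e4 : y - a ≠ y - b := fun e => hab (sub_right_injective e)
  have e5 : y + a ≠ y - b := fun e => hab' (by
    calc a + b = (y + a) - (y - b) := by abel
      _ = 0 := by rw [e, sub_self])
  have e6 : y - a ≠ y + b := fun e => hab' (by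
    calc a + b = (y + b) - (y - a) := by abel
      _ = 0 := by rw [e, sub_self])
  have hpair : ∀ p q : G, p ≠ q → ({z | z = p ∨ z = q} : Set G).ncard = 2 := by
    intro p q hpq
    exact Set.ncard_pair hpq
  have hy := h y
  rw [key]
  by_cases h1 : y ∈ A <;> by_cases h2 : y - a ∈ A <;> by_cases h3 : y ∈ B <;>
    by_cases h4 : y - b ∈ B <;> simp [h1, h2, h3, h4] at hy <;>
    simp only [h1, h2, h3, h4, not_true_eq_false, not_false_eq_true, true_and, false_and,
      false_or, or_false]
  · exact hpair _ _ e2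
  · exact hpair _ _ e6
  · exact hpair _ _ e4
  · exact hpair _ _ e3
  · exact hpair _ _ e5
  · exact hpair _ _ e1

open Classical in
theorem indicator_switchSet_succ (s : ℕ → G) {d : G} (hd : d ≠ 0) {M : ℕ}
    (h1 : s M ∉ switchSet s d M) (h2 : s M + d ∉ switchSet s d M) (y : G) :
    (if y ∈ switchSet s d (M + 1) then 1 else 0) = (if y ∈ switchSet s d M then 1 else 0) +
      ((if y = s M then 1 else 0) + (if y = s M + d then 1 else 0)) := by
  have hiff : y ∈ switchSet s d (M + 1) ↔ y ∈ switchSet s d M ∨ y = s M ∨ y = s M + d := by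
    constructor
    · rintro ⟨i, hi, h⟩
      rcases Nat.lt_succ_iff_lt_or_eq.1 hi with hi | rfl
      · exact Or.inl ⟨i, hi, h⟩
      · exact Or.inr h
    · rintro (h | h)
      · exact switchSet_mono s d (Nat.le_succ M) h
      · exact ⟨M, by omega, h⟩
  by_cases ha : y = s M
  · subst ha
    simp [hiff, h1, hd]
  · by_cases hb : y = s M + d
    · subst hb
      simp [hiff, h2, hd]
    · simp [hiff, ha, hb]

open Classical in
theorem indicator_switchSet (s : ℕ → G) (ha : a ≠ 0) (hb : b ≠ 0) (M : ℕ)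
    (hA : ∀ i < M, s i ∉ switchSet s b i ∧ s i + b ∉ switchSet s b i)
    (hB : ∀ i < M, s i ∉ switchSet s a i ∧ s i + a ∉ switchSet s a i) (y : G) :
    (if y ∈ switchSet s b M then 1 else 0) + (if y - a ∈ switchSet s b M then 1 else 0) =
      (if y ∈ switchSet s a M then 1 else 0) + (if y - b ∈ switchSet s a M then 1 else 0) := by
  induction M with
  | zero => simp [switchSet]
  | succ M ih =>
    have := ih (fun i hi => hA i (by omega)) fun i hi => hB i (by omega)
    obtain ⟨a1, a2⟩ := hA M (by omega)
    obtain ⟨b1, b2⟩ := hB M (by omega)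
    rw [indicator_switchSet_succ s hb a1 a2, indicator_switchSet_succ s hb a1 a2,
      indicator_switchSet_succ s ha b1 b2, indicator_switchSet_succ s ha b1 b2]
    simp only [sub_eq_iff_eq_add, add_right_comm (s M) b a]
    omega

/-- The coefficient of `a` in the switching sequence. -/
def switchCoeff (k i : ℕ) : ℕ := if i < k then i else k - 1 + (i - k + 1) % 2

/-- A connected Cayley graph on two generators decomposes into two Hamiltonian cycles. -/
theorem exists_two_hamiltonian [Fintype G] [DecidableEq G] (g h : ℕ) [NeZero g] [NeZero h]
    (π : G →+ ZMod g) (π' : G →+ ZMod h) (ha : π a = 0) (hb : π b = 1) (ha' : π' a = 1)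
    (hb' : π' b = 0) (hker : ∀ y, π y = 0 → ∃ n : ℕ, y = n • a)
    (hker' : ∀ y, π' y = 0 → ∃ n : ℕ, y = n • b) (hhg : h < g ∨ h = 1 ∧ g = 1)
    (hgb : h ≤ 2 → g • b ≠ 0) (ha2 : a + a ≠ 0) (hb2 : b + b ≠ 0) (hab : a ≠ b)
    (hab' : a + b ≠ 0) :
    ∃ σ τ : Perm G, σ.cycleType = {Fintype.card G} ∧ τ.cycleType = {Fintype.card G} ∧
      ∀ y d, d = a ∨ d = b →
        (σ y = y + d ∨ σ (y + d) = y) ∨ (τ y = y + d ∨ τ (y + d) = y) := by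
  classical
  have ha0 : a ≠ 0 := by rintro rfl; simp at ha2
  have hb0 : b ≠ 0 := by rintro rfl; simp at hb2
  have hg0 := NeZero.pos g
  have hh0 := NeZero.pos h
  obtain ⟨k, hk, hkodd⟩ : ∃ k, (k + 1 = h ∨ k = h ∧ Odd h) ∧ Odd k := by
    rcases Nat.even_or_odd' h with ⟨c, hc | hc⟩
    · exact ⟨h - 1, by omega, by exact ⟨c - 1, by omega⟩⟩
    · exact ⟨h, Or.inr ⟨rfl, c, hc⟩, c, hc⟩
  obtain ⟨M, hM, hModd⟩ : ∃ k, (k + 1 = g ∨ k = g ∧ Odd g) ∧ Odd k := by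
    rcases Nat.even_or_odd' g with ⟨c, hc | hc⟩
    · exact ⟨g - 1, by omega, by exact ⟨c - 1, by omega⟩⟩
    · exact ⟨g, Or.inr ⟨rfl, c, hc⟩, c, hc⟩
  obtain ⟨j, hj⟩ : ∃ j, M = k + 2 * j := by
    obtain ⟨c, rfl⟩ := hkodd
    obtain ⟨d, rfl⟩ := hModd
    exact ⟨d - c, by omega⟩
  have hk0 : 0 < k := hkodd.pos
  let s : ℕ → G := fun i => i • b + switchCoeff k i • a
  have sdef : ∀ i, s i = i • b + switchCoeff k i • a := fun i => rfl
  have hs : ∀ i, π (s i) = i := by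
    intro i
    simp [sdef, ha, hb]
  have hs' : ∀ i < k, π' (s i) = i := by
    intro i hi
    simp [sdef, ha', hb', switchCoeff, hi]
  have hsa : ∀ i, s i + b ≠ s (i + 1) := by
    intro i e
    have hc : switchCoeff k (i + 1) = switchCoeff k i + 1 ∨
        switchCoeff k i = switchCoeff k (i + 1) + 1 := by
      unfold switchCoeff
      split_ifs <;> omega
    rw [sdef, sdef] at e
    rcases hc with hc | hc
    · rw [hc, succ_nsmul, succ_nsmul] at e
      apply ha0
      calc a = (i • b + b + (switchCoeff k i • a + a)) - (i • b + switchCoeff k i • a + b) := by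
            abel
        _ = 0 := by rw [e, sub_self]
    · rw [hc, succ_nsmul, succ_nsmul] at e
      apply ha0
      calc a = (i • b + (switchCoeff k (i + 1) • a + a) + b) -
            (i • b + b + switchCoeff k (i + 1) • a) := by abel
        _ = 0 := by rw [e, sub_self]
  have hsb : ∀ i, i + 1 < k → s i + a ≠ s (i + 1) := by
    intro i hi e
    rw [sdef, sdef, switchCoeff, switchCoeff, if_pos hi, if_pos (by omega), succ_nsmul,
      succ_nsmul] at e
    apply hb0
    calc b = (i • b + b + (i • a + a)) - (i • b + i • a + a) := by abel
      _ = 0 := by rw [e, sub_self]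
  have hs0 : s 0 = 0 := by simp [sdef, switchCoeff, hk0]
  have hcoeff : ∀ n, switchCoeff k (k + 2 * n - 1) = k - 1 := by
    intro n
    unfold switchCoeff
    split_ifs <;> omega
  have hcoeff1 : ∀ n, switchCoeff k (k + 2 * n) = k := by
    intro n
    unfold switchCoeff
    split_ifs <;> omega
  have hwrap : M = g → s (g - 1) + b ≠ s 0 := by
    intro hMg e
    rw [hs0, ← hMg, hj, sdef, hcoeff] at e
    have e2 := congrArg π' e
    simp only [map_add, map_nsmul, hb', ha', mul_zero, zero_add, add_zero, map_zero,
      nsmul_eq_mul, mul_one] at e2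
    rw [ZMod.natCast_eq_zero_iff] at e2
    have hk1 : k = 1 := by
      by_contra hne
      have := Nat.le_of_dvd (by omega) e2
      omega
    apply hgb (by omega)
    rw [← hMg, hj]
    obtain ⟨n, hn⟩ : ∃ n, k + 2 * j = n + 1 := ⟨k + 2 * j - 1, by omega⟩
    rw [hn, succ_nsmul]
    rw [hn, hk1] at e
    simpa using e
  have hwrap' : k = h → s (h - 1) + a ≠ s 0 := by
    intro hkh e
    rw [hs0] at e
    have e2 := congrArg π e
    rw [map_add, hs, ha, add_zero, map_zero, ZMod.natCast_eq_zero_iff] at e2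
    have hh1 : h = 1 := by
      by_contra hne
      have := Nat.le_of_dvd (by omega) e2
      omega
    rw [hh1] at e
    rw [Nat.sub_self, hs0, zero_add] at e
    exact ha0 e
  clear_value s
  set A := switchSet s b M
  set B := switchSet s a M
  -- regularity
  have hdA : ∀ i < M, s i ∉ switchSet s b i ∧ s i + b ∉ switchSet s b i := by
    intro i hi
    have hne : ∀ j < i, s i ≠ s j := by
      intro j hj e
      have := congrArg π e
      rw [hs, hs] at this
      exact natCast_ne_natCast (by omega) (by omega) (by omega) this
    constructor
    · rintro ⟨j, hj, e | e⟩
      · exact hne j hj e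
      · have := congrArg π e
        rw [map_add, hs, hs, hb, ← Nat.cast_one, ← Nat.cast_add] at this
        by_cases hij : i = j + 1
        · subst hij
          exact hsa j e.symm
        · exact natCast_ne_natCast (by omega) (by omega) hij this
    · rintro ⟨j, hj, e | e⟩
      · have := congrArg π e
        rw [map_add, hs, hs, hb, ← Nat.cast_one, ← Nat.cast_add] at this
        by_cases hig : i + 1 < g
        · exact natCast_ne_natCast hig (by omega) (by omega) this
        · have hig' : i + 1 = g := by omega
          rw [hig', ZMod.natCast_self, ← Nat.cast_zero] at this
          by_cases hj0 : j = 0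
          · subst hj0
            apply hwrap (by omega)
            rwa [← hig']
          · exact natCast_ne_natCast hg0 (by omega) (Ne.symm hj0) this
      · exact hne j hj (add_right_cancel e)
  have hdB : ∀ i < M, s i ∉ switchSet s a i ∧ s i + a ∉ switchSet s a i := by
    intro i hi
    have hne : ∀ j < i, π (s i) ≠ π (s j) := by
      intro j hj e
      rw [hs, hs] at e
      exact natCast_ne_natCast (by omega) (by omega) (by omega) e
    constructor <;> rintro ⟨j, hj, e | e⟩ <;> apply hne j hj <;>
      simpa [ha] using congrArg π e
  have hind := indicator_switchSet s ha0 hb0 M hdA hdB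
  -- connectivity of the two colours
  have conn1 : ∀ R : Setoid G, (∀ y, y ∉ A → R y (y + a)) → (∀ y ∈ B, R y (y + b)) →
      ∀ x y, R x y := by
    intro R hR1 hR2
    exact rel_total g π ha hb hker M s (fun i _ => hs i) (fun y hy => hy) hR1
      (fun i hi => hR2 _ ⟨i, hi, Or.inl rfl⟩) (fun i hi => hR2 _ ⟨i, hi, Or.inr rfl⟩)
      hModd.pos (hM.imp_right fun h => ⟨h.1, h.2, fun i _ => hsa i, hwrap h.1⟩)
  have conn2 : ∀ n ≤ j, ∀ R : Setoid G, (∀ y, y ∉ switchSet s a (k + 2 * n) → R y (y + b)) →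
      (∀ y ∈ switchSet s b (k + 2 * n), R y (y + a)) → ∀ x y, R x y := by
    intro n
    induction n with
    | zero =>
      intro _ R hR1 hR2
      exact rel_total h π' hb' ha' hker' k s hs' (fun y hy => hy) hR1
        (fun i hi => hR2 _ ⟨i, hi, Or.inl rfl⟩)
        (fun i hi => hR2 _ ⟨i, hi, Or.inr rfl⟩)
        hk0 (hk.imp_right fun h => ⟨h.1, h.2, hsb, hwrap' h.1⟩)
    | succ n ih =>
      intro hn
      obtain ⟨N, hN⟩ : ∃ N, k + 2 * n = N + 1 := ⟨k + 2 * n - 1, by omega⟩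
      have hN2 : k + 2 * (n + 1) = N + 3 := by omega
      have ih' := ih (by omega)
      rw [hN] at ih'
      rw [hN2]
      have c0 : switchCoeff k N = k - 1 := by
        have := hcoeff n
        rwa [hN, Nat.add_sub_cancel] at this
      have c1 : switchCoeff k (N + 1) = (k - 1) + 1 := by
        have := hcoeff1 n
        rw [hN] at this
        omega
      have c2 : switchCoeff k (N + 2) = k - 1 := by
        have := hcoeff (n + 1)
        rwa [show k + 2 * (n + 1) - 1 = N + 2 by omega] at this
      refine total_switch_step g π ha hb ha2 s hs N (by omega) ?_ ?_ ih'
      · rw [sdef, sdef, c0, c1, succ_nsmul, succ_nsmul]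
        abel
      · rw [sdef, sdef, c0, c2, succ_nsmul, succ_nsmul]
        abel
  have mk : ∀ (d e : G) (C E : Set G), d ≠ 0 → e ≠ 0 → (∀ R : Setoid G,
      (∀ y, y ∉ C → R y (y + d)) → (∀ y ∈ E, R y (y + e)) → ∀ x y, R x y) →
      (switchGraph d e C E).Connected := by
    intro d e C E hd he H
    refine { preconnected := ?_, nonempty := ⟨0⟩ }
    refine H (switchGraph d e C E).reachableSetoid ?_ ?_
    · intro y hy
      exact SimpleGraph.Adj.reachable (by
        rw [switchGraph, SimpleGraph.fromRel_adj]
        exact ⟨by simpa using hd, Or.inl (Or.inl ⟨hy, rfl⟩)⟩)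
    · intro y hy
      exact SimpleGraph.Adj.reachable (by
        rw [switchGraph, SimpleGraph.fromRel_adj]
        exact ⟨by simpa using he, Or.inl (Or.inr ⟨hy, rfl⟩)⟩)
  have conn2' := conn2 j le_rfl
  rw [← hj] at conn2'
  obtain ⟨σ, hσ, hσ'⟩ := exists_hamiltonian (switchGraph a b A B) (mk a b A B ha0 hb0 conn1)
    (ncard_neighborSet_switchGraph ha0 hb0 ha2 hb2 hab hab' hind)
  obtain ⟨τ, hτ, hτ'⟩ := exists_hamiltonian (switchGraph b a B A) (mk b a B A hb0 ha0 conn2')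
    (ncard_neighborSet_switchGraph hb0 ha0 hb2 ha2 hab.symm (by rwa [add_comm])
      fun y => (hind y).symm)
  refine ⟨σ, τ, hσ, hτ, ?_⟩
  rintro y d (rfl | rfl)
  · by_cases hy : y ∈ A
    · refine Or.inr (hτ' _ _ ?_)
      rw [switchGraph, SimpleGraph.fromRel_adj]
      exact ⟨by simpa using ha0, Or.inl (Or.inr ⟨hy, rfl⟩)⟩
    · refine Or.inl (hσ' _ _ ?_)
      rw [switchGraph, SimpleGraph.fromRel_adj]
      exact ⟨by simpa using ha0, Or.inl (Or.inl ⟨hy, rfl⟩)⟩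
  · by_cases hy : y ∈ B
    · refine Or.inl (hσ' _ _ ?_)
      rw [switchGraph, SimpleGraph.fromRel_adj]
      exact ⟨by simpa using hb0, Or.inl (Or.inr ⟨hy, rfl⟩)⟩
    · refine Or.inr (hτ' _ _ ?_)
      rw [switchGraph, SimpleGraph.fromRel_adj]
      exact ⟨by simpa using hb0, Or.inl (Or.inl ⟨hy, rfl⟩)⟩

end Switching
end Oberwolfach

namespace Oberwolfach
open Equiv Equiv.Perm

theorem exists_quotient_hom (t x y : ℕ) [NeZero t] (hc : Nat.gcd (Nat.gcd x y) t = 1) :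
    ∃ π : ZMod t →+ ZMod (Nat.gcd x t), π x = 0 ∧ π y = 1 ∧
      ∀ z, π z = 0 → ∃ n : ℕ, z = n • (x : ZMod t) := by
  have hgt : Nat.gcd x t ∣ t := Nat.gcd_dvd_right x t
  have hcop : Nat.Coprime y (Nat.gcd x t) := by
    rw [Nat.Coprime, ← Nat.gcd_assoc, Nat.gcd_comm y x, hc]
  let u := ZMod.unitOfCoprime y hcop
  refine ⟨(AddMonoidHom.mulLeft (↑u⁻¹ : ZMod (Nat.gcd x t))).comp
    (ZMod.castHom hgt (ZMod (Nat.gcd x t))).toAddMonoidHom, ?_, ?_, ?_⟩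
  · have : (x : ZMod (Nat.gcd x t)) = 0 := (ZMod.natCast_eq_zero_iff _ _).2 (Nat.gcd_dvd_left x t)
    simp [this]
  · have : (y : ZMod (Nat.gcd x t)) = (u : ZMod (Nat.gcd x t)) := rfl
    change (↑u⁻¹ : ZMod (Nat.gcd x t)) * (ZMod.castHom hgt (ZMod (Nat.gcd x t)) (y : ZMod t)) = 1
    rw [map_natCast, this, Units.inv_mul]
  · intro z hz
    change (↑u⁻¹ : ZMod (Nat.gcd x t)) * (ZMod.castHom hgt (ZMod (Nat.gcd x t)) z) = 0 at hz
    rw [Units.mul_right_eq_zero] at hz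
    rw [← ZMod.natCast_zmod_val z, map_natCast, ZMod.natCast_eq_zero_iff] at hz
    obtain ⟨k, hk⟩ := hz
    have hb : ((Nat.gcd x t : ℕ) : ZMod t) = x * (Nat.gcdA x t : ZMod t) := by
      have := congrArg (Int.cast : ℤ → ZMod t) (Nat.gcd_eq_gcd_ab x t)
      push_cast at this
      rw [this]
      simp
    refine ⟨(k * (Nat.gcdA x t : ZMod t)).val, ?_⟩
    rw [nsmul_eq_mul, ZMod.natCast_zmod_val]
    rw [← ZMod.natCast_zmod_val z, hk, Nat.cast_mul, hb]
    ring

theorem natCast_ne_zero {t x : ℕ} (hx : 0 < x) (h : x < t) : (x : ZMod t) ≠ 0 := by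
  rw [Ne, ZMod.natCast_eq_zero_iff]
  exact Nat.not_dvd_of_pos_of_lt hx h

/-- Two differences generating `ZMod t` form a factorable set of differences. -/
theorem factorable_pair {t : ℕ} [NeZero t] {T : Multiset ℕ} (hT : GoodType T t) (x y : ℕ)
    (hx : 0 < x) (hy : 0 < y) (hxt : 2 * x < t) (hyt : 2 * y < t) (hxy : x ≠ y)
    (hc : Nat.gcd (Nat.gcd x y) t = 1) : Factorable T t [(x : ZMod t), -x, y, -y] := by
  have key : ∀ x y : ℕ, 0 < x → 0 < y → 2 * x < t → 2 * y < t → x ≠ y →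
      Nat.gcd (Nat.gcd x y) t = 1 →
      (Nat.gcd y t < Nat.gcd x t ∨ Nat.gcd y t = 1 ∧ Nat.gcd x t = 1) →
      ∃ σ τ : Perm (ZMod t), σ.cycleType = {t} ∧ τ.cycleType = {t} ∧
      ∀ (z d : ZMod t), d = (x : ZMod t) ∨ d = (y : ZMod t) →
        (σ z = z + d ∨ σ (z + d) = z) ∨ (τ z = z + d ∨ τ (z + d) = z) := by
    intro x y hx hy hxt hyt hxy hc hlt
    obtain ⟨π, h1, h2, h3⟩ := exists_quotient_hom t x y hc
    obtain ⟨π', h1', h2', h3'⟩ := exists_quotient_hom t y x (by rwa [Nat.gcd_comm y x])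
    have : NeZero (Nat.gcd x t) := ⟨(Nat.gcd_pos_of_pos_left _ hx).ne'⟩
    have : NeZero (Nat.gcd y t) := ⟨(Nat.gcd_pos_of_pos_left _ hy).ne'⟩
    have := exists_two_hamiltonian (a := (x : ZMod t)) (b := (y : ZMod t)) (Nat.gcd x t)
      (Nat.gcd y t) π π' h1 h2 h2' h1' h3 h3' hlt ?_ ?_ ?_ ?_ ?_
    · simpa only [ZMod.card] using this
    · intro hh e
      rw [nsmul_eq_mul, ← Nat.cast_mul, ZMod.natCast_eq_zero_iff] at e
      have hle : Nat.gcd x t ≤ x := Nat.gcd_le_left _ hx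
      have h5 : t ∣ Nat.gcd x t * Nat.gcd y t := by
        rw [← Nat.gcd_mul_left]
        exact Nat.dvd_gcd e (Nat.dvd_mul_left _ _)
      have h6 := Nat.le_of_dvd (Nat.mul_pos (Nat.gcd_pos_of_pos_left _ hx)
        (Nat.gcd_pos_of_pos_left _ hy)) h5
      have h7 : Nat.gcd x t * Nat.gcd y t ≤ x * 2 := Nat.mul_le_mul hle hh
      omega
    · rw [← Nat.cast_add]
      exact natCast_ne_zero (by omega) (by omega)
    · rw [← Nat.cast_add]
      exact natCast_ne_zero (by omega) (by omega)
    · exact natCast_ne_natCast (by omega) (by omega) hxy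
    · rw [← Nat.cast_add]
      exact natCast_ne_zero (by omega) (by omega)
  have hgg : Nat.Coprime (Nat.gcd x t) (Nat.gcd y t) := by
    refine Nat.Coprime.symm ?_
    refine Nat.eq_one_of_dvd_one ?_
    rw [← hc]
    exact Nat.dvd_gcd (Nat.dvd_gcd ((Nat.gcd_dvd_right _ _).trans (Nat.gcd_dvd_left _ _))
      ((Nat.gcd_dvd_left _ _).trans (Nat.gcd_dvd_left _ _)))
      ((Nat.gcd_dvd_left _ _).trans (Nat.gcd_dvd_right _ _))
  obtain ⟨σ, τ, hσ, hτ, hd⟩ : ∃ σ τ : Perm (ZMod t), σ.cycleType = {t} ∧ τ.cycleType = {t} ∧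
      ∀ (z d : ZMod t), d = (x : ZMod t) ∨ d = (y : ZMod t) →
        (σ z = z + d ∨ σ (z + d) = z) ∨ (τ z = z + d ∨ τ (z + d) = z) := by
    rcases lt_trichotomy (Nat.gcd y t) (Nat.gcd x t) with h | h | h
    · exact key x y hx hy hxt hyt hxy hc (Or.inl h)
    · rw [← h, Nat.coprime_self] at hgg
      exact key x y hx hy hxt hyt hxy hc (Or.inr ⟨hgg, h ▸ hgg⟩)
    · obtain ⟨σ, τ, h1, h2, h3⟩ := key y x hy hx hyt hxt hxy.symm
        (by rwa [Nat.gcd_comm y x]) (Or.inl h)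
      exact ⟨σ, τ, h1, h2, fun z d hd => h3 z d hd.symm⟩
  refine factorable_of_hamiltonian hT (by omega) [σ, τ] ?_ _ (by simp) ?_
  · simp [hσ, hτ]
  · intro z d hmem
    have pos : ∀ z d : ZMod t, d = (x : ZMod t) ∨ d = (y : ZMod t) →
        ∃ ρ ∈ [σ, τ], ρ z = z + d ∨ ρ (z + d) = z := by
      intro z d h
      rcases hd z d h with h | h
      · exact ⟨σ, by simp, h⟩
      · exact ⟨τ, by simp, h⟩
    have neg : ∀ z d : ZMod t, d = (x : ZMod t) ∨ d = (y : ZMod t) →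
        ∃ ρ ∈ [σ, τ], ρ z = z + -d ∨ ρ (z + -d) = z := by
      intro z d h
      obtain ⟨ρ, hρ, h⟩ := pos (z + -d) d h
      rw [neg_add_cancel_right] at h
      exact ⟨ρ, hρ, h.symm⟩
    simp only [List.mem_cons, List.not_mem_nil, or_false] at hmem
    rcases hmem with rfl | rfl | rfl | rfl
    · exact pos _ _ (Or.inl rfl)
    · exact neg _ _ (Or.inl rfl)
    · exact pos _ _ (Or.inr rfl)
    · exact neg _ _ (Or.inr rfl)

end Oberwolfach

namespace Oberwolfach

/-! ### Zigzag paths -/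

/-- The path on natural numbers starting at `lo` with successive steps of lengths
`c + L - 1, …, c + 1, c` in alternating directions. -/
def zigzag (c : ℕ) : ℕ → ℕ → List ℕ
  | lo, 0 => [lo]
  | lo, 1 => [lo, lo + c]
  | lo, n + 2 => lo :: (lo + n + 1 + c) :: zigzag c (lo + 1) n

theorem length_zigzag (c lo L : ℕ) : (zigzag c lo L).length = L + 1 := by
  induction L using Nat.strong_induction_on generalizing lo with
  | _ L ih =>
    match L with
    | 0 => rfl
    | 1 => rfl
    | n + 2 => simp [zigzag, ih n (by omega)]

theorem zigzag_eq_cons (c lo L : ℕ) : ∃ l, zigzag c lo L = lo :: l := by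
  match L with
  | 0 => exact ⟨_, rfl⟩
  | 1 => exact ⟨_, rfl⟩
  | n + 2 => exact ⟨_, rfl⟩

theorem zigzag_ne_nil (c lo L : ℕ) : zigzag c lo L ≠ [] := by
  obtain ⟨l, hl⟩ := zigzag_eq_cons c lo L
  simp [hl]

theorem mem_zigzag {c lo L x : ℕ} (hc : 0 < c) (hx : x ∈ zigzag c lo L) :
    lo ≤ x ∧ x < lo + L + c ∧ (x ≤ lo + L / 2 ∨ lo + L / 2 + c ≤ x) := by
  induction L using Nat.strong_induction_on generalizing lo with
  | _ L ih =>
    match L with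
    | 0 =>
      simp only [zigzag, List.mem_singleton] at hx
      omega
    | 1 =>
      simp only [zigzag, List.mem_cons, List.not_mem_nil, or_false] at hx
      omega
    | n + 2 =>
      simp only [zigzag, List.mem_cons] at hx
      rcases hx with rfl | rfl | hx
      · omega
      · omega
      · have := ih n (by omega) hx
        omega

theorem nodup_zigzag {c : ℕ} (hc : 0 < c) (lo L : ℕ) : (zigzag c lo L).Nodup := by
  induction L using Nat.strong_induction_on generalizing lo with
  | _ L ih =>
    match L with
    | 0 => simp [zigzag]
    | 1 => simp [zigzag, hc.ne']
    | n + 2 =>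
      rw [zigzag, List.nodup_cons, List.nodup_cons]
      refine ⟨?_, ?_, ih n (by omega) _⟩
      · rw [List.mem_cons]
        rintro (h | h)
        · omega
        · have := mem_zigzag hc h
          omega
      · intro h
        have := mem_zigzag hc h
        omega

theorem infix_zigzag {c L l : ℕ} (lo : ℕ) (h1 : c ≤ l) (h2 : l < c + L) :
    ∃ i, if (c + L - 1 - l) % 2 = 0 then [i, i + l] <:+: zigzag c lo L
      else [i + l, i] <:+: zigzag c lo L := by
  induction L using Nat.strong_induction_on generalizing lo with
  | _ L ih =>
    match L with
    | 0 => omega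
    | 1 =>
      obtain rfl : l = c := by omega
      exact ⟨lo, by simp [zigzag]⟩
    | n + 2 =>
      rcases (by omega : l = c + n + 1 ∨ l = c + n ∨ l < c + n) with rfl | rfl | h
      · refine ⟨lo, ?_⟩
        rw [if_pos (by omega), zigzag, show lo + (c + n + 1) = lo + n + 1 + c by ring]
        exact ⟨[], _, rfl⟩
      · obtain ⟨l', hl'⟩ := zigzag_eq_cons c (lo + 1) n
        refine ⟨lo + 1, ?_⟩
        rw [if_neg (by omega), zigzag, hl', show lo + 1 + (c + n) = lo + n + 1 + c by ring]
        exact ⟨[lo], l', rfl⟩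
      · obtain ⟨i, hi⟩ := ih n (by omega) (lo + 1) h
        refine ⟨i, ?_⟩
        have hpar : (c + (n + 2) - 1 - l) % 2 = (c + n - 1 - l) % 2 := by omega
        rw [hpar, zigzag]
        split_ifs at hi ⊢
        · exact hi.trans ⟨[lo, lo + n + 1 + c], [], by simp⟩
        · exact hi.trans ⟨[lo, lo + n + 1 + c], [], by simp⟩

/-! ### Nested edges -/

/-- The nested edges `(lo + i, lo + M + 2 * b - 2 - i)` for `i < b`. -/
def nest : ℕ → ℕ → ℕ → List (ℕ × ℕ)
  | 0, _, _ => []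
  | b + 1, lo, M => (lo, lo + M + 2 * b) :: nest b (lo + 1) M

@[simp] theorem length_nest (b lo M : ℕ) : (nest b lo M).length = b := by
  induction b generalizing lo with
  | zero => rfl
  | succ b ih => simp [nest, ih]

theorem mem_ends_nest {b lo M x : ℕ} (h : x ∈ ends (nest b lo M)) :
    (lo ≤ x ∧ x < lo + b) ∨ (lo + M + b ≤ x + 1 ∧ x + 1 < lo + M + 2 * b) := by
  induction b generalizing lo with
  | zero => simp [nest, ends] at h
  | succ b ih =>
    rw [nest, ends, List.flatMap_cons, List.mem_append, ← ends] at h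
    rcases h with h | h
    · simp only [List.mem_cons, List.not_mem_nil, or_false] at h
      omega
    · have := ih h
      omega

theorem nodup_ends_nest (b lo : ℕ) {M : ℕ} (hM : 0 < M) : (ends (nest b lo M)).Nodup := by
  induction b generalizing lo with
  | zero => simp [nest, ends]
  | succ b ih =>
    rw [nest, ends, List.flatMap_cons, ← ends, List.cons_append, List.cons_append,
      List.nil_append, List.nodup_cons, List.nodup_cons, List.mem_cons]
    refine ⟨?_, ?_, ih _⟩
    · rintro (h | h)
      · omega
      · have := mem_ends_nest h
        omega
    · intro h
      have := mem_ends_nest h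
      omega

theorem mem_nest {b lo M j : ℕ} (hj : j < b) : ∃ u, (u, u + (M + 2 * j)) ∈ nest b lo M := by
  induction b generalizing lo with
  | zero => omega
  | succ b ih =>
    rcases Nat.lt_succ_iff_lt_or_eq.1 hj with h | rfl
    · obtain ⟨u, hu⟩ := ih h (lo := lo + 1)
      exact ⟨u, List.mem_cons_of_mem _ hu⟩
    · exact ⟨lo, by rw [nest, ← add_assoc]; exact List.mem_cons_self⟩

/-! ### Remaining differences -/

/-- The integers of `[lo, lo + n)` other than the even ones of `[M, M + 2 * b)`. -/
def rest (b M lo n : ℕ) : List ℕ :=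
  (List.range' lo n).filter fun i => ¬(i % 2 = 0 ∧ M ≤ i ∧ i < M + 2 * b)

theorem mem_rest {b M lo n i : ℕ} :
    i ∈ rest b M lo n ↔ (lo ≤ i ∧ i < lo + n) ∧ ¬(i % 2 = 0 ∧ M ≤ i ∧ i < M + 2 * b) := by
  rw [rest, List.mem_filter, List.mem_range'_1, decide_eq_true_eq]

theorem length_rest {b M lo n : ℕ} (hM : M % 2 = 0) (hlo : lo ≤ M)
    (h : b = 0 ∨ M + 2 * b ≤ lo + n + 1) : (rest b M lo n).length + b = n := by
  have h1 := List.length_eq_length_filter_add (l := List.range' lo n)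
    fun i => decide ¬(i % 2 = 0 ∧ M ≤ i ∧ i < M + 2 * b)
  rw [List.length_range'] at h1
  rw [rest]
  have h2 : ((List.range' lo n).filter fun i =>
      !decide ¬(i % 2 = 0 ∧ M ≤ i ∧ i < M + 2 * b)).length = b := by
    rw [← List.toFinset_card_of_nodup ((List.nodup_range' (s := lo) (n := n)).filter _)]
    have : ((List.range' lo n).filter fun i =>
        !decide ¬(i % 2 = 0 ∧ M ≤ i ∧ i < M + 2 * b)).toFinset =
        (Finset.range b).image fun j => M + 2 * j := by
      ext i
      simp only [List.toFinset_filter, Finset.mem_filter, List.mem_toFinset, List.mem_range'_1,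
        Finset.mem_image, Finset.mem_range, decide_not, Bool.not_not, decide_eq_true_eq]
      constructor
      · rintro ⟨h3, h4⟩
        exact ⟨(i - M) / 2, by omega, by omega⟩
      · rintro ⟨j, hj, rfl⟩
        omega
    rw [this, Finset.card_image_of_injective _ fun i j hij => by simpa using hij,
      Finset.card_range]
  omega

/-- The differences `±i` for `i ∈ S`. -/
def plusMinus (t : ℕ) (S : List ℕ) : List (ZMod t) := S.flatMap fun i : ℕ => [(i : ZMod t), -i]

@[simp] theorem length_plusMinus (t : ℕ) (S : List ℕ) : (plusMinus t S).length = 2 * S.length := by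
  induction S with
  | nil => rfl
  | cons x S ih =>
    rw [plusMinus, List.flatMap_cons, List.length_append, ← plusMinus, ih]
    simp
    ring

theorem mem_plusMinus {t i : ℕ} {S : List ℕ} (h : i ∈ S) :
    (i : ZMod t) ∈ plusMinus t S ∧ -(i : ZMod t) ∈ plusMinus t S :=
  ⟨List.mem_flatMap.2 ⟨i, h, by simp⟩, List.mem_flatMap.2 ⟨i, h, by simp⟩⟩

theorem factorable_plusMinus_filter {t : ℕ} [NeZero t] {T : Multiset ℕ} (hT : GoodType T t)
    (p : ℕ → Bool) (n lo : ℕ) (hlo : 0 < lo) (ht : 2 * (lo + n) < t + 2)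
    (hp : ∀ i, p i = false → i % 2 = 0) (heven : ((List.range' lo n).filter p).length % 2 = 0) :
    Factorable T t (plusMinus t ((List.range' lo n).filter p)) := by
  induction n using Nat.strong_induction_on generalizing lo with
  | _ n ih =>
    match n with
    | 0 => exact Factorable.nil T t
    | n + 1 =>
      rw [List.range'_succ] at heven ⊢
      by_cases h0 : p lo = true
      · match n with
        | 0 => simp [h0] at heven
        | n + 1 =>
          rw [List.range'_succ] at heven ⊢
          by_cases h1 : p (lo + 1) = true
          · rw [List.filter_cons_of_pos h0, List.filter_cons_of_pos h1] at heven ⊢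
            have := ih n (by omega) (lo + 1 + 1) (by omega) (by omega)
              (by simp only [List.length_cons] at heven; omega)
            refine (factorable_pair hT lo (lo + 1) hlo (by omega) (by omega) (by omega)
              (by omega) ?_).append this
            simp
          · rw [List.filter_cons_of_pos h0, List.filter_cons_of_neg h1] at heven ⊢
            have hlo2 := hp _ (by simpa using h1)
            match n with
            | 0 => simp at heven
            | n + 1 =>
              rw [List.range'_succ] at heven ⊢
              have h2 : p (lo + 1 + 1) = true := by
                by_contra hne
                have := hp _ (by simpa using hne)
                omega
              rw [List.filter_cons_of_pos h2] at heven ⊢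
              have := ih n (by omega) (lo + 1 + 1 + 1) (by omega) (by omega)
                (by simp only [List.length_cons] at heven; omega)
              refine (factorable_pair hT lo (lo + 1 + 1) hlo (by omega) (by omega) (by omega)
                (by omega) ?_).append this
              have : Nat.gcd lo (lo + 1 + 1) = 1 := by
                rw [add_assoc, Nat.gcd_self_add_right]
                exact Nat.Coprime.symm (Nat.coprime_two_left.2 (Nat.odd_iff.2 (by omega)))
              rw [this, Nat.gcd_one_left]
      · rw [List.filter_cons_of_neg h0] at heven ⊢
        exact ih n (by omega) (lo + 1) (by omega) (by omega) heven

theorem factorable_plusMinus_rest {t : ℕ} [NeZero t] {T : Multiset ℕ} (hT : GoodType T t)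
    {b M lo n : ℕ} (hlo : 0 < lo) (ht : 2 * (lo + n) < t + 2)
    (heven : (rest b M lo n).length % 2 = 0) : Factorable T t (plusMinus t (rest b M lo n)) :=
  factorable_plusMinus_filter hT _ n lo hlo ht (fun i hi => by simp at hi; exact hi.1) heven

/-! ### Differences covered by edges and paths -/

/-- The difference `d` occurs along an edge of `E` or a step of a path of `Q`. -/
def Covers (t : ℕ) (E : List (ℕ × ℕ)) (Q : List (List ℕ)) (d : ZMod t) : Prop :=
  ∃ u v : ℕ, ((u, v) ∈ E ∨ ∃ P ∈ Q, [u, v] <:+: P) ∧ (v : ZMod t) = u + d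

/-- The translate by `h` of the reversed edges. -/
def flipUp (h : ℕ) (E : List (ℕ × ℕ)) : List (ℕ × ℕ) := E.map fun e => (e.2 + h, e.1 + h)

@[simp] theorem length_flipUp (h : ℕ) (E : List (ℕ × ℕ)) : (flipUp h E).length = E.length := by
  simp [flipUp]

theorem ends_flipUp_perm (h : ℕ) (E : List (ℕ × ℕ)) :
    (ends (flipUp h E)).Perm ((ends E).map (· + h)) := by
  induction E with
  | nil => exact List.Perm.refl _
  | cons e E ih =>
    simp only [flipUp, ends, List.map_cons, List.flatMap_cons, List.map_append] at ih ⊢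
    exact List.Perm.append (List.Perm.swap _ _ _) ih

variable {t : ℕ} {E : List (ℕ × ℕ)} {Q : List (List ℕ)}

theorem covers_nest {b lo M h i : ℕ} (hE : ∀ e ∈ nest b lo M, e ∈ E)
    (hE' : ∀ e ∈ flipUp h (nest b lo M), e ∈ E) (hM : M % 2 = 0) (h1 : i % 2 = 0) (h2 : M ≤ i)
    (h3 : i < M + 2 * b) : Covers t E Q i ∧ Covers t E Q (-i) := by
  obtain ⟨u, hu⟩ := mem_nest (b := b) (lo := lo) (M := M) (j := (i - M) / 2) (by omega)
  rw [show M + 2 * ((i - M) / 2) = i by omega] at hu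
  refine ⟨⟨u, u + i, Or.inl (hE _ hu), by push_cast; ring⟩,
    ⟨u + i + h, u + h, Or.inl (hE' _ (List.mem_map.2 ⟨_, hu, rfl⟩)), by push_cast; ring⟩⟩

theorem infix_reverse {u v : ℕ} {P : List ℕ} (h : [u, v] <:+: P) : [v, u] <:+: P.reverse := by
  have := List.reverse_infix.2 h
  simpa using this

theorem infix_map_add {u v : ℕ} {P : List ℕ} (h : [u, v] <:+: P) (k : ℕ) :
    [u + k, v + k] <:+: P.map (· + k) := by
  have := h.map (· + k)
  simpa using this

/-- A zigzag and a reversed shifted zigzag ending with the same step lengths cover all the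
common differences with both signs. -/
theorem covers_zigzag {c c' L L' lo lo' h l : ℕ} {P P' : List ℕ} (hP : P ∈ Q) (hP' : P' ∈ Q)
    (hcL : c + L = c' + L') (h1 : c ≤ l) (h1' : c' ≤ l) (h2 : l < c + L)
    (hsub : (zigzag c lo L <:+: P ∧ ((zigzag c' lo' L').map (· + h)).reverse <:+: P') ∨
      ((zigzag c lo L).reverse <:+: P ∧ (zigzag c' lo' L').map (· + h) <:+: P')) :
    Covers t E Q l ∧ Covers t E Q (-l) := by
  obtain ⟨i, hi⟩ := infix_zigzag lo h1 h2
  obtain ⟨j, hj⟩ := infix_zigzag lo' h1' (by omega : l < c' + L')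
  rw [← hcL] at hj
  have up : ∀ {u v : ℕ} (d : ZMod t), [u, v] <:+: P → (v : ZMod t) = u + d → Covers t E Q d :=
    fun d hi hd => ⟨_, _, Or.inr ⟨P, hP, hi⟩, hd⟩
  have up' : ∀ {u v : ℕ} (d : ZMod t), [u, v] <:+: P' → (v : ZMod t) = u + d → Covers t E Q d :=
    fun d hi hd => ⟨_, _, Or.inr ⟨P', hP', hi⟩, hd⟩
  rcases hsub with ⟨s1, s2⟩ | ⟨s1, s2⟩ <;> split_ifs at hi hj
  · exact ⟨up _ (hi.trans s1) (by push_cast; ring),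
      up' _ ((infix_reverse (infix_map_add hj h)).trans s2) (by push_cast; ring)⟩
  · exact ⟨up' _ ((infix_reverse (infix_map_add hj h)).trans s2) (by push_cast; ring),
      up _ (hi.trans s1) (by push_cast; ring)⟩
  · exact ⟨up' _ ((infix_map_add hj h).trans s2) (by push_cast; ring),
      up _ ((infix_reverse hi).trans s1) (by push_cast; ring)⟩
  · exact ⟨up _ ((infix_reverse hi).trans s1) (by push_cast; ring),
      up' _ ((infix_map_add hj h).trans s2) (by push_cast; ring)⟩

/-- The difference `h` is covered by the link of the two halves. -/
theorem covers_link (c c' L L' lo h : ℕ)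
    (hQ : (zigzag c lo L).reverse ++ (zigzag c' lo L').map (· + h) ∈ Q) : Covers t E Q h := by
  obtain ⟨l, hl⟩ := zigzag_eq_cons c lo L
  obtain ⟨l', hl'⟩ := zigzag_eq_cons c' lo L'
  refine ⟨lo, lo + h, Or.inr ⟨_, hQ, ?_⟩, by push_cast; ring⟩
  rw [hl, hl']
  exact ⟨l.reverse, l'.map (· + h), by simp⟩

theorem exists_natCast_or_neg [NeZero t] {d : ZMod t} (hd : d ≠ 0) :
    ∃ i : ℕ, 0 < i ∧ 2 * i ≤ t ∧ (d = i ∨ d = -i) := by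
  have h1 : d.val ≠ 0 := by rwa [Ne, ZMod.val_eq_zero]
  have h2 := ZMod.val_lt d
  by_cases h : 2 * d.val ≤ t
  · exact ⟨d.val, by omega, h, Or.inl (ZMod.natCast_zmod_val d).symm⟩
  · refine ⟨t - d.val, by omega, by omega, Or.inr ?_⟩
    rw [Nat.cast_sub h2.le, ZMod.natCast_self, ZMod.natCast_zmod_val]
    ring

end Oberwolfach

namespace Oberwolfach

/-- The set containing the vertices of `nest b 0 M` and of `zigzag c b L`. -/
def Occupied (c L b M x : ℕ) : Prop :=
  x < b ∨ (b + M ≤ x + 1 ∧ x + 1 < M + 2 * b) ∨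
    (b ≤ x ∧ x < b + L + c ∧ (x ≤ b + L / 2 ∨ b + L / 2 + c ≤ x))

theorem occupied_of_mem {c L b M x : ℕ} (hc : 0 < c)
    (h : x ∈ ends (nest b 0 M) ++ zigzag c b L) : Occupied c L b M x := by
  rcases List.mem_append.1 h with h | h
  · have := mem_ends_nest h
    unfold Occupied
    omega
  · exact Or.inr (Or.inr (mem_zigzag hc h))

theorem nodup_half {c L b M : ℕ} (hc : 0 < c) (hM : c + L + 1 ≤ M) :
    (ends (nest b 0 M) ++ zigzag c b L).Nodup := by
  refine (nodup_ends_nest b 0 (by omega)).append (nodup_zigzag hc b L) ?_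
  intro x h1 h2
  have := mem_ends_nest h1
  have := mem_zigzag hc h2
  omega

theorem Occupied.lt {c L b M x h : ℕ} (hx : Occupied c L b M x) (hh : b + L + c ≤ h)
    (hb : b = 0 ∨ M + 2 * b ≤ h + 1) : x < h := by
  unfold Occupied at hx
  omega

theorem ends_append (E F : List (ℕ × ℕ)) : ends (E ++ F) = ends E ++ ends F :=
  List.flatMap_append

/-- Two disjoint halves, the second one shifted by `h`, and extra edges are disjoint. -/
theorem nodup_layout {I X : List (ℕ × ℕ)} {A B V : List ℕ} {h : ℕ} (hA : (ends I ++ A).Nodup)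
    (hB : (ends I ++ B).Nodup) (hlt : ∀ x ∈ ends I ++ A, x < h) (hX : (ends X).Nodup)
    (hXA : ∀ x ∈ ends X, x ∉ ends I ++ A) (hXB : ∀ y ∈ ends I ++ B, y + h ∉ ends X)
    (hV : V.Perm (A ++ B.map (· + h))) : (ends (I ++ flipUp h I ++ X) ++ V).Nodup := by
  have hp : (ends (I ++ flipUp h I ++ X) ++ V).Perm
      (ends X ++ ((ends I ++ A) ++ (ends I ++ B).map (· + h))) := by
    rw [ends_append, ends_append, List.map_append]
    refine (((ends_flipUp_perm h I).append_left _).append_right _).append hV |>.trans ?_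
    rw [List.perm_iff_count]
    intro x
    simp only [List.count_append]
    omega
  rw [hp.nodup_iff]
  refine hX.append (hA.append (hB.map (add_left_injective h)) ?_) ?_
  · intro x h1 h2
    obtain ⟨y, -, rfl⟩ := List.mem_map.1 h2
    have := hlt _ h1
    omega
  · intro x h1 h2
    rcases List.mem_append.1 h2 with h2 | h2
    · exact hXA x h1 h2
    · obtain ⟨y, hy, rfl⟩ := List.mem_map.1 h2
      exact hXB y hy h1

theorem lt_of_mem_layout {I X : List (ℕ × ℕ)} {A B V : List ℕ} {h t : ℕ}
    (hA : ∀ x ∈ ends I ++ A, x < h) (hB : ∀ x ∈ ends I ++ B, x < h) (ht : 2 * h ≤ t)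
    (hX : ∀ x ∈ ends X, x < t) (hV : V.Perm (A ++ B.map (· + h))) :
    ∀ x ∈ ends (I ++ flipUp h I ++ X) ++ V, x < t := by
  intro x hx
  rw [ends_append, ends_append, List.mem_append, List.mem_append, List.mem_append, hV.mem_iff,
    (ends_flipUp_perm h I).mem_iff, List.mem_append] at hx
  rcases hx with ((hx | hx) | hx) | hx | hx
  · have := hA x (List.mem_append_left _ hx)
    omega
  · obtain ⟨y, hy, rfl⟩ := List.mem_map.1 hx
    have := hA y (List.mem_append_left _ hy)
    omega
  · exact hX x hx
  · have := hA x (List.mem_append_right _ hx)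
    omega
  · obtain ⟨y, hy, rfl⟩ := List.mem_map.1 hx
    have := hB y (List.mem_append_right _ hy)
    omega

theorem Covers.mono {t : ℕ} {E E' : List (ℕ × ℕ)} {Q : List (List ℕ)} {d : ZMod t}
    (h : Covers t E Q d) (hE : ∀ e ∈ E, e ∈ E') : Covers t E' Q d := by
  obtain ⟨u, v, huv, hd⟩ := h
  exact ⟨u, v, huv.imp_left (hE _), hd⟩

/-- Solutions from forests made of two zigzags, two families of nested edges and a few extra
edges `X`. -/
theorem hasOPSolution_append_singleton_of_layout (m : List ℕ) (h2 : ∀ x ∈ m, 2 ≤ x) (t : ℕ)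
    [NeZero t] (hs : 0 < m.sum) (hsol : HasOPSolution m) {h c c' L L' b M n : ℕ}
    (X : List (ℕ × ℕ)) (Q : List (List ℕ))
    (hQ : Q = [zigzag c b L, ((zigzag c' b L').map (· + h)).reverse] ∨
      Q = [(zigzag c b L).reverse ++ (zigzag c' b L').map (· + h)])
    (hc : 0 < c) (hc' : 0 < c') (hcL : c + L = c' + L') (hM : c + L + 1 ≤ M) (hM2 : M % 2 = 0)
    (hbh : b + L + c ≤ h) (hbM : b = 0 ∨ M + 2 * b ≤ h + 1) (hht : 2 * h ≤ t)
    (hX : (ends X).Nodup) (hXt : ∀ x ∈ ends X, x < t)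
    (hXA : ∀ x ∈ ends X, ¬ Occupied c L b M x)
    (hXB : ∀ y, y + h ∈ ends X → ¬ Occupied c' L' b M y)
    (hE : 2 * b + X.length = (m.filter (fun x => x % 2 = 1)).length)
    (hQl : 2 * Q.length ≤ m.sum + (2 * b + X.length))
    (hcount : t + Q.length = m.sum + (2 * b + X.length) + (L + L' + 2))
    (D : List (ZMod t)) (hD : Factorable {t} t D) (hn : 2 * (c + L + n) < t + 2)
    (hbn : b = 0 ∨ M + 2 * b ≤ c + L + n + 1) (hnb : (n + b) % 2 = 0)
    (hDl : D.length + 2 * n = m.sum - 1 + 2 * b)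
    (hcov : ∀ i : ℕ, 0 < i → 2 * i ≤ t → (i < c ∨ i < c' ∨ c + L + n ≤ i) →
      ∀ d : ZMod t, d = i ∨ d = -i → d ∈ D ∨ Covers t X Q d) : HasOPSolution (m ++ [t]) := by
  have hrl := length_rest (b := b) (M := M) (lo := c + L) (n := n) hM2 (by omega) hbn
  have ltA : ∀ x ∈ ends (nest b 0 M) ++ zigzag c b L, x < h :=
    fun x hx => (occupied_of_mem hc hx).lt hbh hbM
  have ltB : ∀ x ∈ ends (nest b 0 M) ++ zigzag c' b L', x < h :=
    fun x hx => (occupied_of_mem hc' hx).lt (by omega) hbM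
  have hperm : Q.flatten.Perm (zigzag c b L ++ (zigzag c' b L').map (· + h)) := by
    rcases hQ with rfl | rfl
    · simp only [List.flatten_cons, List.flatten_nil, List.append_nil]
      exact (List.reverse_perm _).append_left _
    · simp only [List.flatten_cons, List.flatten_nil, List.append_nil]
      exact (List.reverse_perm _).append_right _
  have hElen : (nest b 0 M ++ flipUp h (nest b 0 M) ++ X).length = 2 * b + X.length := by
    simp
    ring
  refine hasOPSolution_append_singleton_of_forest m h2 t hs hsol
    (nest b 0 M ++ flipUp h (nest b 0 M) ++ X) Q (by rw [hElen, hE]) ?_ (by rwa [hElen])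
    (nodup_layout (nodup_half hc hM) (nodup_half hc' (by omega)) ltA hX
      (fun x hx hx' => hXA x hx (occupied_of_mem hc hx'))
      (fun y hy hy' => hXB y hy' (occupied_of_mem hc' hy)) hperm)
    (lt_of_mem_layout ltA ltB hht hXt hperm) ?_
    (D ++ plusMinus t (rest b M (c + L) n))
    (hD.append (factorable_plusMinus_rest (Or.inl rfl) (by omega) hn (by omega))) ?_ ?_
  · rcases hQ with rfl | rfl <;> simp [zigzag_ne_nil]
  · rw [hElen, hperm.length_eq, List.length_append, List.length_map, length_zigzag, length_zigzag]
    omega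
  · rw [List.length_append, length_plusMinus]
    omega
  · intro d hd
    obtain ⟨i, hi0, hit, hdi⟩ := exists_natCast_or_neg hd
    change _ ∨ Covers t _ Q d
    rw [List.mem_append]
    by_cases h1 : i < c ∨ i < c' ∨ c + L + n ≤ i
    · rcases hcov i hi0 hit h1 d hdi with h3 | h3
      · exact Or.inl (Or.inl h3)
      · exact Or.inr (h3.mono fun e he => List.mem_append_right _ he)
    · push Not at h1
      by_cases h3 : i < c + L
      · right
        have : Covers t (nest b 0 M ++ flipUp h (nest b 0 M) ++ X) Q i ∧
            Covers t (nest b 0 M ++ flipUp h (nest b 0 M) ++ X) Q (-i) := by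
          rcases hQ with rfl | rfl
          · exact covers_zigzag (List.mem_cons_self) (List.mem_cons_of_mem _ List.mem_cons_self)
              hcL h1.1 h1.2.1 h3 (Or.inl ⟨List.infix_refl _, List.infix_refl _⟩)
          · exact covers_zigzag (List.mem_cons_self) (List.mem_cons_self)
              hcL h1.1 h1.2.1 h3 (Or.inr ⟨(List.prefix_append _ _).isInfix,
                (List.suffix_append _ _).isInfix⟩)
        rcases hdi with rfl | rfl
        · exact this.1
        · exact this.2
      · by_cases h4 : i % 2 = 0 ∧ M ≤ i ∧ i < M + 2 * b
        · right
          have := covers_nest (t := t) (Q := Q) (lo := 0) (h := h)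
            (E := nest b 0 M ++ flipUp h (nest b 0 M) ++ X)
            (fun e he => List.mem_append_left _ (List.mem_append_left _ he))
            (fun e he => List.mem_append_left _ (List.mem_append_right _ he)) hM2 h4.1 h4.2.1
            h4.2.2
          rcases hdi with rfl | rfl
          · exact this.1
          · exact this.2
        · left
          right
          have := mem_plusMinus (t := t) (mem_rest.2 ⟨⟨by omega, h1.2.2⟩, h4⟩)
          rcases hdi with rfl | rfl
          · exact this.1
          · exact this.2

end Oberwolfach

namespace Oberwolfach

theorem length_filter_odd_mod_two (m : List ℕ) :
    (m.filter (fun x => x % 2 = 1)).length % 2 = m.sum % 2 := by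
  induction m with
  | nil => rfl
  | cons x m ih =>
    by_cases hx : x % 2 = 1
    · rw [List.filter_cons_of_pos (by simpa using hx), List.length_cons, List.sum_cons]
      omega
    · rw [List.filter_cons_of_neg (by simpa using hx), List.sum_cons]
      omega

theorem mem_ends_singleton {x u v : ℕ} : x ∈ ends [(u, v)] ↔ x = u ∨ x = v := by
  simp [ends]

theorem mem_ends_pair {x u v u' v' : ℕ} :
    x ∈ ends [(u, v), (u', v')] ↔ x = u ∨ x = v ∨ x = u' ∨ x = v' := by
  simp [ends]

theorem nodup_ends_singleton {u v : ℕ} (h : u ≠ v) : (ends [(u, v)]).Nodup := by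
  simp [ends, h]

theorem nodup_ends_pair {u v u' v' : ℕ} (h1 : u ≠ v) (h2 : u' ≠ v') (h3 : u ≠ u') (h4 : u ≠ v')
    (h5 : v ≠ u') (h6 : v ≠ v') : (ends [(u, v), (u', v')]).Nodup := by
  simp [ends, h1, h2, h3, h4, h5, h6]

theorem half_eq_neg (h : ℕ) : (h : ZMod (2 * h)) = -(h : ZMod (2 * h)) := by
  rw [eq_neg_iff_add_eq_zero, ← two_mul]
  have := ZMod.natCast_self (2 * h)
  push_cast at this
  exact this

theorem covers_edge {t : ℕ} {E : List (ℕ × ℕ)} {Q : List (List ℕ)} {d : ZMod t} {u v : ℕ}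
    (h : (u, v) ∈ E) (hd : (v : ZMod t) = u + d) : Covers t E Q d :=
  ⟨u, v, Or.inl h, hd⟩

theorem exists_even_between (k : ℕ) : ∃ M, M % 2 = 0 ∧ k + 1 ≤ M ∧ M ≤ k + 2 :=
  ⟨2 * (k / 2 + 1), by omega, by omega, by omega⟩

variable (m : List ℕ) (h2 : ∀ x ∈ m, 2 ≤ x) (hsol : HasOPSolution m)
include h2 hsol

theorem hasOPSolution_append_singleton_even_odd (h : ℕ) (ht : m.sum < 2 * h)
    (ha : (m.filter (fun x => x % 2 = 1)).length ≤ 2 * h - m.sum) (hodd : m.sum % 2 = 1) :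
    HasOPSolution (m ++ [2 * h]) := by
  have h3 := three_mul_odd_le m h2
  have hpar := length_filter_odd_mod_two m
  have : NeZero (2 * h) := ⟨by omega⟩
  obtain ⟨b, hb⟩ : ∃ b, (m.filter (fun x => x % 2 = 1)).length = 2 * b + 1 :=
    ⟨(m.filter (fun x => x % 2 = 1)).length / 2, by omega⟩
  obtain ⟨r, hr⟩ : ∃ r, m.sum = 2 * r + 1 := ⟨m.sum / 2, by omega⟩
  obtain ⟨L, hL⟩ : ∃ L, L + b + r + 1 = h := ⟨h - (b + r + 1), by omega⟩
  rcases Nat.mod_two_eq_zero_or_one r with hr2 | hr2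
  · obtain ⟨M, hM2, hM, hM'⟩ := exists_even_between (1 + L)
    refine hasOPSolution_append_singleton_of_layout m h2 (2 * h) (by omega) hsol (h := h) (c := 1)
      (c' := 1) (L := L) (L' := L) (b := b) (M := M) (n := h - 1 - L) [(h - 1, h - 1 + h)] _
      (Or.inl rfl) (by omega) (by omega) rfl hM hM2 (by omega) (by omega) le_rfl
      (nodup_ends_singleton (by omega)) ?_ ?_ ?_ hb.symm ?_ ?_ [] (Factorable.nil _ _) (by omega)
      (by omega) (by omega) ?_ ?_
    · intro x hx
      rw [mem_ends_singleton] at hx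
      omega
    · intro x hx
      rw [mem_ends_singleton] at hx
      unfold Occupied
      omega
    · intro x hx
      rw [mem_ends_singleton] at hx
      unfold Occupied
      omega
    · simp only [List.length_cons, List.length_nil]
      omega
    · simp only [List.length_cons, List.length_nil]
      omega
    · simp only [List.length_nil]
      omega
    · intro i hi0 hi hic d hd
      obtain rfl : i = h := by omega
      rw [← half_eq_neg, or_self] at hd
      exact Or.inr (covers_edge List.mem_cons_self (by rw [hd]; push_cast; ring))
  · obtain ⟨M, hM2, hM, hM'⟩ := exists_even_between (2 + L)
    refine hasOPSolution_append_singleton_of_layout m h2 (2 * h) (by omega) hsol (h := h) (c := 2)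
      (c' := 2) (L := L) (L' := L) (b := b) (M := M) (n := h - 2 - L)
      [(b + L / 2 + 1, b + L / 2 + 1 + h)] _
      (Or.inl rfl) (by omega) (by omega) rfl hM hM2 (by omega) (by omega) le_rfl
      (nodup_ends_singleton (by omega)) ?_ ?_ ?_ hb.symm ?_ ?_ [1, -1]
      (factorable_unit_pair (Or.inl rfl) (by omega) isUnit_one) (by omega)
      (by omega) (by omega) ?_ ?_
    · intro x hx
      rw [mem_ends_singleton] at hx
      omega
    · intro x hx
      rw [mem_ends_singleton] at hx
      unfold Occupied
      omega
    · intro x hx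
      rw [mem_ends_singleton] at hx
      unfold Occupied
      omega
    · simp only [List.length_cons, List.length_nil]
      omega
    · simp only [List.length_cons, List.length_nil]
      omega
    · simp only [List.length_cons, List.length_nil]
      omega
    · intro i hi0 hi hic d hd
      rcases (by omega : i = h ∨ i = 1) with rfl | rfl
      · rw [← half_eq_neg, or_self] at hd
        exact Or.inr (covers_edge List.mem_cons_self (by rw [hd]; push_cast; ring))
      · exact Or.inl (by simpa using hd)

end Oberwolfach

namespace Oberwolfach

theorem factorable_pred_half (h : ℕ) [NeZero (2 * h)] (h2 : h % 2 = 0) {T : Multiset ℕ}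
    (hT : GoodType T (2 * h)) (hh : 0 < h) :
    Factorable T (2 * h) [((h - 1 : ℕ) : ZMod (2 * h)), -((h - 1 : ℕ) : ZMod (2 * h))] := by
  refine factorable_unit_pair hT (by omega) ?_
  rw [ZMod.isUnit_iff_coprime]
  obtain ⟨k, rfl⟩ : ∃ k, h = k + 1 := ⟨h - 1, by omega⟩
  rw [Nat.add_sub_cancel, show 2 * (k + 1) = 2 + k * 2 by ring, Nat.coprime_add_mul_left_right,
    Nat.coprime_two_right]
  exact Nat.odd_iff.2 (by omega)

theorem exists_pred_half_complement (h n b : ℕ) [NeZero (2 * h)] (hh : 0 < h)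
    (hpar : (n + b) % 2 = 0 ∨ h % 2 = 0 ∧ 0 < n) :
    ∃ (U : List (ZMod (2 * h))) (k : ℕ), Factorable {2 * h} (2 * h) U ∧
      U.length + 2 * k = 2 * n ∧ (k + b) % 2 = 0 ∧ (k = n ∨ k + 1 = n ∧ h % 2 = 0 ∧
        ((h - 1 : ℕ) : ZMod (2 * h)) ∈ U ∧ -((h - 1 : ℕ) : ZMod (2 * h)) ∈ U) := by
  rcases Nat.mod_two_eq_zero_or_one (n + b) with h0 | h0
  · exact ⟨[], n, Factorable.nil _ _, by simp, h0, Or.inl rfl⟩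
  · exact ⟨_, n - 1, factorable_pred_half h (by omega) (Or.inl rfl) hh,
      by simp only [List.length_cons, List.length_nil]; omega, by omega,
      Or.inr ⟨by omega, by omega, by simp, by simp⟩⟩

theorem covers_step {t : ℕ} {E : List (ℕ × ℕ)} {Q : List (List ℕ)} {c L lo l h : ℕ}
    {P : List ℕ} (hP : P ∈ Q) (hsub : (zigzag c lo L).map (· + h) <:+: P) (h1 : c ≤ l)
    (h2 : l < c + L) : Covers t E Q (if (c + L - 1 - l) % 2 = 0 then l else -l) := by
  obtain ⟨i, hi⟩ := infix_zigzag lo h1 h2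
  split_ifs at hi ⊢
  · exact ⟨_, _, Or.inr ⟨P, hP, (infix_map_add hi h).trans hsub⟩, by push_cast; ring⟩
  · exact ⟨_, _, Or.inr ⟨P, hP, (infix_map_add hi h).trans hsub⟩, by push_cast; ring⟩

theorem exists_factorable_or_covers_step {t : ℕ} [NeZero t] {E : List (ℕ × ℕ)}
    {Q : List (List ℕ)} {c L lo l h : ℕ} {P : List ℕ} (ht : 2 ≤ t) (hP : P ∈ Q)
    (hsub : (zigzag c lo L).map (· + h) <:+: P) (h1 : c ≤ l) (h2 : l < c + L)
    (hu : IsUnit (l : ZMod t)) :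
    ∃ e : ZMod t, Factorable {t} t [e] ∧ ∀ d : ZMod t, d = l ∨ d = -l → d = e ∨ Covers t E Q d := by
  have := covers_step (t := t) (E := E) hP hsub h1 h2
  split_ifs at this
  · refine ⟨-l, factorable_unit ht hu.neg, ?_⟩
    rintro d (rfl | rfl)
    · exact Or.inr this
    · exact Or.inl rfl
  · refine ⟨l, factorable_unit ht hu, ?_⟩
    rintro d (rfl | rfl)
    · exact Or.inl rfl
    · exact Or.inr this

variable (m : List ℕ) (h2 : ∀ x ∈ m, 2 ≤ x) (hsol : HasOPSolution m)
include h2 hsol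

theorem hasOPSolution_append_singleton_even_even_of_odd (h : ℕ) (ht : m.sum < 2 * h)
    (ha : (m.filter (fun x => x % 2 = 1)).length ≤ 2 * h - m.sum) (hs : 0 < m.sum)
    (heven : m.sum % 4 = 0) (hh : h % 2 = 1) : HasOPSolution (m ++ [2 * h]) := by
  have h3 := three_mul_odd_le m h2
  have hpar := length_filter_odd_mod_two m
  have : NeZero (2 * h) := ⟨by omega⟩
  obtain ⟨b, hb⟩ : ∃ b, (m.filter (fun x => x % 2 = 1)).length = 2 * b :=
    ⟨(m.filter (fun x => x % 2 = 1)).length / 2, by omega⟩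
  obtain ⟨L, hL⟩ : ∃ L, 2 * (L + b) + m.sum = 2 * h := ⟨h - (b + m.sum / 2), by omega⟩
  obtain ⟨M, hM2, hM, hM'⟩ := exists_even_between (2 + L)
  refine hasOPSolution_append_singleton_of_layout m h2 (2 * h) (by omega) hsol (h := h) (c := 2)
    (c' := 2) (L := L) (L' := L) (b := b) (M := M) (n := h - 2 - L) [] _
    (Or.inl rfl) (by omega) (by omega) rfl hM hM2 (by omega) (by omega) le_rfl
    List.nodup_nil (by simp [ends]) (by simp [ends]) (by simp [ends]) hb.symm ?_ ?_ _
    (factorable_one_neg_one_half h rfl (Nat.odd_iff.2 hh)) (by omega) (by omega) (by omega) ?_ ?_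
  · simp only [List.length_cons, List.length_nil]
    omega
  · simp only [List.length_cons, List.length_nil]
    omega
  · simp only [List.length_cons, List.length_nil]
    omega
  · intro i hi0 hi hic d hd
    rcases (by omega : i = h ∨ i = 1) with rfl | rfl
    · rw [← half_eq_neg, or_self] at hd
      exact Or.inl (by simp [hd])
    · rw [Nat.cast_one] at hd
      rcases hd with rfl | rfl <;> exact Or.inl (by simp)

theorem hasOPSolution_append_singleton_even_even (h : ℕ) (ht : m.sum < 2 * h)
    (ha : (m.filter (fun x => x % 2 = 1)).length ≤ 2 * h - m.sum) (hs : 0 < m.sum)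
    (heven : m.sum % 2 = 0) (hh : m.sum % 4 = 2 ∨ h % 2 = 0) : HasOPSolution (m ++ [2 * h]) := by
  have h3 := three_mul_odd_le m h2
  have hpar := length_filter_odd_mod_two m
  have : NeZero (2 * h) := ⟨by omega⟩
  have hone : Factorable {2 * h} (2 * h) [(1 : ZMod (2 * h))] :=
    factorable_unit (by omega) isUnit_one
  obtain ⟨b, hb⟩ : ∃ b, (m.filter (fun x => x % 2 = 1)).length = 2 * b :=
    ⟨(m.filter (fun x => x % 2 = 1)).length / 2, by omega⟩
  obtain ⟨k, rfl⟩ : ∃ k, h = k + 2 := ⟨h - 2, by omega⟩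
  rcases b with _ | b
  · obtain ⟨L, hL⟩ : ∃ L, 2 * L + m.sum = 2 * (k + 1) := ⟨k + 1 - m.sum / 2, by omega⟩
    obtain ⟨M, hM2, hM, hM'⟩ := exists_even_between (2 + L)
    obtain ⟨U, n, hU, hUn, hn0, hn⟩ := exists_pred_half_complement (k + 2) (k - L) 0 (by omega) (by omega)
    obtain ⟨e, he, hcov⟩ := exists_factorable_or_covers_step (t := 2 * (k + 2)) (E := [])
      (h := k + 2) (l := 1) (c := 1) (L := L + 1) (lo := 0)
      (Q := [(zigzag 2 0 L).reverse ++ (zigzag 1 0 (L + 1)).map (· + (k + 2))]) (by omega)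
      List.mem_cons_self (List.suffix_append _ _).isInfix le_rfl (by omega) (by simp)
    refine hasOPSolution_append_singleton_of_layout m h2 (2 * (k + 2)) (by omega) hsol
      (h := k + 2) (c := 2) (c' := 1) (L := L) (L' := L + 1) (b := 0) (M := M) (n := n) [] _
      (Or.inr rfl) (by omega) (by omega) (by omega) hM hM2 (by omega) (by omega) le_rfl
      List.nodup_nil (by simp [ends]) (by simp [ends]) (by simp [ends]) hb.symm ?_ ?_ _
      (he.append hU) (by omega) (by omega) (by omega) ?_ ?_
    · simp only [List.length_cons, List.length_nil]
      omega
    · simp only [List.length_cons, List.length_nil]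
      omega
    · simp only [List.length_cons, List.length_nil, List.length_append]
      omega
    · intro i hi0 hi hic d hd
      rcases (by omega : i = k + 2 ∨ i = 1 ∨ (i = k + 1 ∧ n ≠ k - L)) with rfl | rfl | ⟨rfl, hne⟩
      · rw [← half_eq_neg, or_self] at hd
        rw [hd]
        exact Or.inr (covers_link 2 1 L (L + 1) 0 (k + 2) List.mem_cons_self)
      · rcases hcov d hd with rfl | h
        · exact Or.inl (by simp)
        · exact Or.inr h
      · have := (hn.resolve_left hne).2.2
        rw [show k + 2 - 1 = k + 1 from rfl] at this
        rcases hd with rfl | rfl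
        · exact Or.inl (List.mem_append_right _ this.1)
        · exact Or.inl (List.mem_append_right _ this.2)
  · obtain ⟨L, hL⟩ : ∃ L, 2 * (L + b) + m.sum = 2 * (k + 1) :=
      ⟨k + 1 - (b + m.sum / 2), by omega⟩
    obtain ⟨M, hM2, hM, hM'⟩ := exists_even_between (2 + L)
    obtain ⟨U, n, hU, hUn, hn0, hn⟩ := exists_pred_half_complement (k + 2) (k - L) b (by omega) (by omega)
    refine hasOPSolution_append_singleton_of_layout m h2 (2 * (k + 2)) (by omega) hsol
      (h := k + 2) (c := 2) (c' := 2) (L := L) (L' := L) (b := b) (M := M) (n := n)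
      [(b + L / 2 + 1, b + L / 2 + 1 + (k + 2)), (k + 1, k)] _
      (Or.inl rfl) (by omega) (by omega) rfl hM hM2 (by omega) (by omega) le_rfl
      (nodup_ends_pair (by omega) (by omega) (by omega) (by omega) (by omega) (by omega)) ?_ ?_ ?_
      hb.symm ?_ ?_ _ (hone.append hU) (by omega) (by omega) (by omega) ?_ ?_
    · intro x hx
      rw [mem_ends_pair] at hx
      omega
    · intro x hx
      rw [mem_ends_pair] at hx
      unfold Occupied
      omega
    · intro x hx
      rw [mem_ends_pair] at hx
      unfold Occupied
      omega
    · simp only [List.length_cons, List.length_nil]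
      omega
    · simp only [List.length_cons, List.length_nil]
      omega
    · simp only [List.length_cons, List.length_nil, List.length_append]
      omega
    · intro i hi0 hi hic d hd
      rcases (by omega : i = k + 2 ∨ i = 1 ∨ (i = k + 1 ∧ n ≠ k - L)) with rfl | rfl | ⟨rfl, hne⟩
      · rw [← half_eq_neg, or_self] at hd
        exact Or.inr (covers_edge List.mem_cons_self (by rw [hd]; push_cast; ring))
      · rw [Nat.cast_one] at hd
        rcases hd with rfl | rfl
        · exact Or.inl (by simp)
        · exact Or.inr (covers_edge (List.mem_cons_of_mem _ List.mem_cons_self)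
            (by push_cast; ring))
      · have := (hn.resolve_left hne).2.2
        rw [show k + 2 - 1 = k + 1 from rfl] at this
        rcases hd with rfl | rfl
        · exact Or.inl (List.mem_append_right _ this.1)
        · exact Or.inl (List.mem_append_right _ this.2)

end Oberwolfach

namespace Oberwolfach

theorem isUnit_natCast_half (h : ℕ) : IsUnit (h : ZMod (2 * h + 1)) := by
  rw [ZMod.isUnit_iff_coprime, show 2 * h + 1 = 1 + h * 2 by ring,
    Nat.coprime_add_mul_left_right]
  exact Nat.coprime_one_right h

theorem isUnit_two_of_odd (h : ℕ) : IsUnit ((2 : ℕ) : ZMod (2 * h + 1)) := by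
  rw [ZMod.isUnit_iff_coprime, Nat.coprime_two_left]
  exact odd_two_mul_add_one h

variable (m : List ℕ) (h2 : ∀ x ∈ m, 2 ≤ x) (hsol : HasOPSolution m)
include h2 hsol

theorem hasOPSolution_append_singleton_odd_even (h : ℕ) (ht : m.sum < 2 * h + 1)
    (ha : (m.filter (fun x => x % 2 = 1)).length ≤ 2 * h - m.sum) (hs : 0 < m.sum)
    (heven : m.sum % 2 = 0) : HasOPSolution (m ++ [2 * h + 1]) := by
  have h3 := three_mul_odd_le m h2
  have hpar := length_filter_odd_mod_two m
  have hneg : Factorable {2 * h + 1} (2 * h + 1) [-(h : ZMod (2 * h + 1))] :=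
    factorable_unit (by omega) (isUnit_natCast_half h).neg
  obtain ⟨b, hb⟩ : ∃ b, (m.filter (fun x => x % 2 = 1)).length = 2 * b :=
    ⟨(m.filter (fun x => x % 2 = 1)).length / 2, by omega⟩
  obtain ⟨r, hr⟩ : ∃ r, m.sum = 2 * (r + 1) := ⟨m.sum / 2 - 1, by omega⟩
  obtain ⟨L, hL⟩ : ∃ L, L + b + r + 1 = h := ⟨h - (b + r + 1), by omega⟩
  rcases Nat.mod_two_eq_zero_or_one r with hr2 | hr2
  · obtain ⟨M, hM2, hM, hM'⟩ := exists_even_between (1 + L)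
    refine hasOPSolution_append_singleton_of_layout m h2 (2 * h + 1) hs hsol (h := h) (c := 1)
      (c' := 1) (L := L) (L' := L) (b := b) (M := M) (n := h - 1 - L) [] _
      (Or.inr rfl) (by omega) (by omega) rfl hM hM2 (by omega) (by omega) (by omega)
      List.nodup_nil (by simp [ends]) (by simp [ends]) (by simp [ends]) hb.symm ?_ ?_ _
      hneg (by omega) (by omega) (by omega) ?_ ?_
    · simp only [List.length_cons, List.length_nil]
      omega
    · simp only [List.length_cons, List.length_nil]
      omega
    · simp only [List.length_cons, List.length_nil]
      omega
    · intro i hi0 hi hic d hd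
      obtain rfl : i = h := by omega
      rcases hd with rfl | rfl
      · exact Or.inr (covers_link 1 1 L L b i List.mem_cons_self)
      · exact Or.inl List.mem_cons_self
  · obtain ⟨M, hM2, hM, hM'⟩ := exists_even_between (2 + L)
    refine hasOPSolution_append_singleton_of_layout m h2 (2 * h + 1) hs hsol (h := h) (c := 2)
      (c' := 2) (L := L) (L' := L) (b := b) (M := M) (n := h - 2 - L) [] _
      (Or.inr rfl) (by omega) (by omega) rfl hM hM2 (by omega) (by omega) (by omega)
      List.nodup_nil (by simp [ends]) (by simp [ends]) (by simp [ends]) hb.symm ?_ ?_ _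
      (hneg.append (factorable_unit_pair (Or.inl rfl) (by omega) isUnit_one))
      (by omega) (by omega) (by omega) ?_ ?_
    · simp only [List.length_cons, List.length_nil]
      omega
    · simp only [List.length_cons, List.length_nil]
      omega
    · simp only [List.length_cons, List.length_nil, List.length_append]
      omega
    · intro i hi0 hi hic d hd
      rcases (by omega : i = h ∨ i = 1) with rfl | rfl
      · rcases hd with rfl | rfl
        · exact Or.inr (covers_link 2 2 L L b i List.mem_cons_self)
        · exact Or.inl List.mem_cons_self
      · rw [Nat.cast_one] at hd
        rcases hd with rfl | rfl <;> exact Or.inl (by simp)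

theorem hasOPSolution_append_singleton_odd_odd_of_even (h r : ℕ) (hr : m.sum = 2 * r + 1)
    (hr2 : r % 2 = 0) (hr0 : 0 < r) (ht : m.sum < 2 * h + 1)
    (ha : (m.filter (fun x => x % 2 = 1)).length ≤ 2 * h - m.sum) :
    HasOPSolution (m ++ [2 * h + 1]) := by
  have h3 := three_mul_odd_le m h2
  have hpar := length_filter_odd_mod_two m
  obtain ⟨b, hb⟩ : ∃ b, (m.filter (fun x => x % 2 = 1)).length = 2 * b + 1 :=
    ⟨(m.filter (fun x => x % 2 = 1)).length / 2, by omega⟩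
  obtain ⟨L, hL⟩ : ∃ L, L + 1 + b + r = h := ⟨h - (b + r + 1), by omega⟩
  obtain ⟨M, hM2, hM, hM'⟩ := exists_even_between (2 + L)
  obtain ⟨x, y, hxy, hcov⟩ : ∃ x y : ℕ, (x = 2 * h - 1 ∧ y = 2 * h ∨ x = 2 * h ∧ y = 2 * h - 1) ∧
      ∀ d : ZMod (2 * h + 1), d = 1 ∨ d = -1 → Covers (2 * h + 1) [(x, y)]
        [zigzag 2 b L, ((zigzag 1 b (L + 1)).map (· + h)).reverse] d := by
    obtain ⟨i, hi⟩ := infix_zigzag b (c := 1) (L := L + 1) le_rfl (by omega)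
    have hc : ((2 * h - 1 : ℕ) : ZMod (2 * h + 1)) = (2 * h : ℕ) - 1 := by
      rw [Nat.cast_sub (by omega), Nat.cast_one]
    split_ifs at hi
    · refine ⟨2 * h - 1, 2 * h, Or.inl ⟨rfl, rfl⟩, ?_⟩
      rintro d (rfl | rfl)
      · exact covers_edge List.mem_cons_self (by rw [hc]; ring)
      · exact ⟨_, _, Or.inr ⟨_, List.mem_cons_of_mem _ List.mem_cons_self,
          infix_reverse (infix_map_add hi h)⟩, by push_cast; ring⟩
    · refine ⟨2 * h, 2 * h - 1, Or.inr ⟨rfl, rfl⟩, ?_⟩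
      rintro d (rfl | rfl)
      · exact ⟨_, _, Or.inr ⟨_, List.mem_cons_of_mem _ List.mem_cons_self,
          infix_reverse (infix_map_add hi h)⟩, by push_cast; ring⟩
      · exact covers_edge List.mem_cons_self (by rw [hc]; ring)
  refine hasOPSolution_append_singleton_of_layout m h2 (2 * h + 1) (by omega) hsol (h := h)
    (c := 2) (c' := 1) (L := L) (L' := L + 1) (b := b) (M := M) (n := r + b) [(x, y)] _
    (Or.inl rfl) (by omega) (by omega) (by omega) hM hM2 (by omega) (by omega) (by omega)
    (nodup_ends_singleton (by omega)) ?_ ?_ ?_ hb.symm ?_ ?_ [] (Factorable.nil _ _) (by omega)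
    (by omega) (by omega) ?_ ?_
  · intro x hx
    rw [mem_ends_singleton] at hx
    omega
  · intro x hx
    rw [mem_ends_singleton] at hx
    unfold Occupied
    omega
  · intro x hx
    rw [mem_ends_singleton] at hx
    unfold Occupied
    omega
  · simp only [List.length_cons, List.length_nil]
    omega
  · simp only [List.length_cons, List.length_nil]
    omega
  · simp only [List.length_nil]
    omega
  · intro i hi0 hi hic d hd
    obtain rfl : i = 1 := by omega
    exact Or.inr (hcov d (by simpa using hd))

theorem hasOPSolution_append_singleton_odd_odd_of_odd (h r : ℕ) (hr : m.sum = 2 * r + 1)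
    (hr2 : r % 2 = 1) (hr3 : 3 ≤ r) (ht : m.sum < 2 * h + 1)
    (ha : (m.filter (fun x => x % 2 = 1)).length ≤ 2 * h - m.sum) :
    HasOPSolution (m ++ [2 * h + 1]) := by
  have h3 := three_mul_odd_le m h2
  have hpar := length_filter_odd_mod_two m
  obtain ⟨b, hb⟩ : ∃ b, (m.filter (fun x => x % 2 = 1)).length = 2 * b + 1 :=
    ⟨(m.filter (fun x => x % 2 = 1)).length / 2, by omega⟩
  obtain ⟨L, hL⟩ : ∃ L, L + 1 + b + r = h := ⟨h - (b + r + 1), by omega⟩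
  obtain ⟨M, hM2, hM, hM'⟩ := exists_even_between (2 + L)
  refine hasOPSolution_append_singleton_of_layout m h2 (2 * h + 1) (by omega) hsol (h := h)
    (c := 2) (c' := 2) (L := L) (L' := L) (b := b) (M := M) (n := h - 2 - L)
    [(2 * h, 2 * h - 1)] _
    (Or.inr rfl) (by omega) (by omega) (by omega) hM hM2 (by omega) (by omega) (by omega)
    (nodup_ends_singleton (by omega)) ?_ ?_ ?_ hb.symm ?_ ?_ _
    ((factorable_unit (by omega) (isUnit_natCast_half h).neg).append
      (factorable_unit (by omega) isUnit_one)) (by omega) (by omega) (by omega) ?_ ?_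
  · intro x hx
    rw [mem_ends_singleton] at hx
    omega
  · intro x hx
    rw [mem_ends_singleton] at hx
    unfold Occupied
    omega
  · intro x hx
    rw [mem_ends_singleton] at hx
    unfold Occupied
    omega
  · simp only [List.length_cons, List.length_nil]
    omega
  · simp only [List.length_cons, List.length_nil]
    omega
  · simp only [List.length_cons, List.length_nil, List.length_append]
    omega
  · intro i hi0 hi hic d hd
    rcases (by omega : i = h ∨ i = 1) with rfl | rfl
    · rcases hd with rfl | rfl
      · exact Or.inr (covers_link 2 2 L L b i List.mem_cons_self)
      · exact Or.inl List.mem_cons_self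
    · rw [Nat.cast_one] at hd
      rcases hd with rfl | rfl
      · exact Or.inl (by simp)
      · refine Or.inr (covers_edge List.mem_cons_self ?_)
        rw [Nat.cast_sub (by omega), Nat.cast_one]
        ring

theorem hasOPSolution_append_singleton_five (hs : m.sum = 3) : HasOPSolution (m ++ [5]) := by
  have h3 := three_mul_odd_le m h2
  have hpar := length_filter_odd_mod_two m
  refine hasOPSolution_append_singleton_of_forest m h2 5 (by omega) hsol [(1, 0)] [[2, 3]]
    (by simp only [List.length_cons, List.length_nil]; omega) (by simp) (by simp [hs])
    (by decide) (by decide) (by simp [hs]) _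
    ((factorable_unit (by omega) (isUnit_two_of_odd 2)).append
      (factorable_unit (by omega) (isUnit_two_of_odd 2).neg)) (by simp [hs]) ?_
  intro d hd
  have hd' : d = 1 ∨ d = -1 ∨ d = 2 ∨ d = -2 := by
    revert d
    decide
  rcases hd' with rfl | rfl | rfl | rfl
  · exact Or.inr ⟨2, 3, Or.inr ⟨_, List.mem_cons_self, List.infix_refl _⟩, by decide⟩
  · exact Or.inr ⟨1, 0, Or.inl List.mem_cons_self, by decide⟩
  · exact Or.inl (by simp)
  · exact Or.inl (by simp)

theorem hasOPSolution_append_singleton_odd_three (h : ℕ) (hs : m.sum = 3) (hh : 3 ≤ h) :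
    HasOPSolution (m ++ [2 * h + 1]) := by
  have h3 := three_mul_odd_le m h2
  have hpar := length_filter_odd_mod_two m
  have hb : (m.filter (fun x => x % 2 = 1)).length = 1 := by omega
  obtain ⟨k, rfl⟩ : ∃ k, h = k + 3 := ⟨h - 3, by omega⟩
  obtain ⟨M, hM2, hM, hM'⟩ := exists_even_between (3 + k)
  obtain ⟨Q, hQ⟩ : ∃ Q, Q = [(zigzag 3 0 k).reverse ++ (zigzag 1 0 (k + 2)).map (· + (k + 3))] :=
    ⟨_, rfl⟩
  have hmem : (zigzag 3 0 k).reverse ++ (zigzag 1 0 (k + 2)).map (· + (k + 3)) ∈ Q := by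
    rw [hQ]
    exact List.mem_cons_self
  obtain ⟨x, y, hxy, hcov⟩ : ∃ x y : ℕ, (x = k / 2 + 1 ∧ y = k / 2 + 2 ∨
      x = k / 2 + 2 ∧ y = k / 2 + 1) ∧
      ∀ d : ZMod (2 * (k + 3) + 1), d = (1 : ℕ) ∨ d = -(1 : ℕ) →
        Covers (2 * (k + 3) + 1) [(x, y)] Q d := by
    rcases Nat.mod_two_eq_zero_or_one (k + 1) with hk | hk
    · refine ⟨_, _, Or.inr ⟨rfl, rfl⟩, ?_⟩
      have := covers_step (t := 2 * (k + 3) + 1) (E := [(k / 2 + 2, k / 2 + 1)]) hmem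
        (List.suffix_append _ _).isInfix le_rfl (by omega)
      rw [if_pos (by omega)] at this
      rintro d (rfl | rfl)
      · exact this
      · exact covers_edge List.mem_cons_self (by push_cast; ring)
    · refine ⟨_, _, Or.inl ⟨rfl, rfl⟩, ?_⟩
      have := covers_step (t := 2 * (k + 3) + 1) (E := [(k / 2 + 1, k / 2 + 2)]) hmem
        (List.suffix_append _ _).isInfix le_rfl (by omega)
      rw [if_neg (by omega)] at this
      rintro d (rfl | rfl)
      · exact covers_edge List.mem_cons_self (by push_cast; ring)
      · exact this
  obtain ⟨e, he, hcov2⟩ := exists_factorable_or_covers_step (t := 2 * (k + 3) + 1)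
    (E := [(x, y)]) (by omega) hmem (List.suffix_append _ _).isInfix (by omega) (by omega)
    (isUnit_two_of_odd (k + 3))
  refine hasOPSolution_append_singleton_of_layout m h2 (2 * (k + 3) + 1) (by omega) hsol
    (h := k + 3) (c := 3) (c' := 1) (L := k) (L' := k + 2) (b := 0) (M := M) (n := 0)
    [(x, y)] Q (Or.inr hQ) (by omega) (by omega) (by omega) hM hM2 (by omega) (by omega)
    (by omega) (nodup_ends_singleton (by omega)) ?_ ?_ ?_ hb.symm ?_ ?_ _
    ((factorable_unit (by omega) (isUnit_natCast_half (k + 3)).neg).append he) (by omega)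
    (by omega) (by omega) ?_ ?_
  · intro x hx
    rw [mem_ends_singleton] at hx
    omega
  · intro x hx
    rw [mem_ends_singleton] at hx
    unfold Occupied
    omega
  · intro x hx
    rw [mem_ends_singleton] at hx
    omega
  · rw [hQ]
    simp only [List.length_cons, List.length_nil]
    omega
  · rw [hQ]
    simp only [List.length_cons, List.length_nil]
    omega
  · simp only [List.length_cons, List.length_nil, List.length_append]
    omega
  · intro i hi0 hi hic d hd
    rcases (by omega : i = k + 3 ∨ i = 1 ∨ i = 2) with rfl | rfl | rfl
    · rcases hd with rfl | rfl
      · exact Or.inr (covers_link 3 1 k (k + 2) 0 (k + 3) hmem)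
      · exact Or.inl List.mem_cons_self
    · exact Or.inr (hcov d hd)
    · rcases hcov2 d hd with rfl | h
      · exact Or.inl (by simp)
      · exact Or.inr h

end Oberwolfach

namespace Oberwolfach

/-- The set containing the vertices of `nest b 0 M` and of `nest p b N`. -/
def NestOccupied (b M p N x : ℕ) : Prop :=
  x < b ∨ (b + M ≤ x + 1 ∧ x + 1 < M + 2 * b) ∨ (b ≤ x ∧ x < b + p) ∨
    (b + N + p ≤ x + 1 ∧ x + 1 < b + N + 2 * p)

theorem nestOccupied_of_mem {b M p N x : ℕ} (h : x ∈ ends (nest b 0 M) ++ ends (nest p b N)) :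
    NestOccupied b M p N x := by
  unfold NestOccupied
  rcases List.mem_append.1 h with h | h
  · have := mem_ends_nest h
    omega
  · have := mem_ends_nest h
    omega

theorem nodup_nest_append_nest {b M p N : ℕ} (hN : 0 < N) (hM : N + 2 * p ≤ M) :
    (ends (nest b 0 M) ++ ends (nest p b N)).Nodup := by
  refine (nodup_ends_nest b 0 (by omega)).append (nodup_ends_nest p b hN) ?_
  intro x h1 h2
  have := mem_ends_nest h1
  have := mem_ends_nest h2
  omega

theorem exists_edge_of_mem {t : ℕ} {F : List (ℕ × ℕ)} {x y : ℕ} {c d : ZMod t}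
    (h : (x, y) ∈ F ∨ (y, x) ∈ F) (hc : (y : ZMod t) = x + c) (hd : d = c ∨ d = -c) :
    ∃ u v : ℕ, ((u, v) ∈ F ∨ (v, u) ∈ F) ∧ (v : ZMod t) = u + d := by
  rcases hd with rfl | rfl
  · exact ⟨x, y, h, hc⟩
  · exact ⟨y, x, h.symm, by rw [hc]; ring⟩

/-- Solutions from forests made of four families of nested edges and a few extra edges `X`. -/
theorem hasOPSolution_append_twos_of_layout (m : List ℕ) (h2 : ∀ x ∈ m, 2 ≤ x) (h : ℕ)
    [NeZero (2 * h)] (hs : 0 < m.sum) (hsol : HasOPSolution m) {c L b M N n p q : ℕ}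
    (X : List (ℕ × ℕ)) (hN : 0 < N) (hN2 : N % 2 = 1) (hNc : c ≤ N) (hNc' : N ≤ c + 1)
    (hp : c + L ≤ N + 2 * p) (hp' : N + 2 * p ≤ c + L + 1)
    (hq : c + L ≤ 2 + 2 * q) (hq' : 2 + 2 * q ≤ c + L + 1) (hpq : p + q = L)
    (hM : c + L + 1 ≤ M) (hM2 : M % 2 = 0)
    (hbh : b + L + c ≤ h)
    (hX : (ends X).Nodup) (hXt : ∀ x ∈ ends X, x < 2 * h)
    (hXA : ∀ x ∈ ends X, ¬ NestOccupied b M p N x)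
    (hXB : ∀ y, y + h ∈ ends X → ¬ NestOccupied b M q 2 y)
    (hE : 2 * b + X.length = (m.filter (fun x => x % 2 = 1)).length)
    (hcount : 2 * h = m.sum + (2 * b + X.length) + 2 * L)
    (D : List (ZMod (2 * h)))
    (hD : Factorable (List.replicate (2 * h / 2) 2 : List ℕ) (2 * h) D) (hn : c + L + n ≤ h)
    (hbn : b = 0 ∨ M + 2 * b ≤ c + L + n + 1) (hnb : (n + b) % 2 = 0)
    (hDl : D.length + 2 * n = m.sum - 1 + 2 * b)
    (hcov : ∀ i : ℕ, 0 < i → i ≤ h → (i < c ∨ c + L + n ≤ i) →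
      ∀ d : ZMod (2 * h), d = i ∨ d = -i → d ∈ D ∨ Covers (2 * h) X [] d) :
    HasOPSolution (m ++ List.replicate (2 * h / 2) 2) := by
  have hrl := length_rest (b := b) (M := M) (lo := c + L) (n := n) hM2 (by omega) hbn
  have ltA : ∀ x ∈ ends (nest b 0 M) ++ ends (nest p b N), x < h := by
    intro x hx
    have := nestOccupied_of_mem hx
    unfold NestOccupied at this
    omega
  have ltB : ∀ x ∈ ends (nest b 0 M) ++ ends (nest q b 2), x < h := by
    intro x hx
    have := nestOccupied_of_mem hx
    unfold NestOccupied at this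
    omega
  have hperm : (ends (nest p b N ++ flipUp h (nest q b 2))).Perm
      (ends (nest p b N) ++ (ends (nest q b 2)).map (· + h)) := by
    rw [ends_append]
    exact (ends_flipUp_perm _ _).append_left _
  have hElen : (nest b 0 M ++ flipUp h (nest b 0 M) ++ X).length = 2 * b + X.length := by
    simp
    ring
  refine hasOPSolution_append_twos_of_forest m h2 (2 * h) hs hsol
    (nest b 0 M ++ flipUp h (nest b 0 M) ++ X) (nest p b N ++ flipUp h (nest q b 2))
    (by rw [hElen, hE])
    (nodup_layout (nodup_nest_append_nest hN (by omega))
      (nodup_nest_append_nest (by omega) (by omega)) ltA hX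
      (fun x hx hx' => hXA x hx (nestOccupied_of_mem hx'))
      (fun y hy hy' => hXB y hy' (nestOccupied_of_mem hy)) hperm)
    (lt_of_mem_layout ltA ltB le_rfl hXt hperm) ?_ (even_two_mul h)
    (D ++ plusMinus (2 * h) (rest b M (c + L) n))
    (hD.append (factorable_plusMinus_rest (Or.inr ⟨even_two_mul h, rfl⟩) (by omega) (by omega)
      (by omega))) ?_ ?_
  · rw [hElen, List.length_append, length_flipUp, length_nest, length_nest, hpq, hcount]
  · rw [List.length_append, length_plusMinus]
    omega
  · intro d hd
    obtain ⟨i, hi0, hit, hdi⟩ := exists_natCast_or_neg hd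
    have key : d ∈ D ++ plusMinus (2 * h) (rest b M (c + L) n) ∨
        Covers (2 * h) (nest b 0 M ++ flipUp h (nest b 0 M) ++ X) [] d ∨
        ∃ u v : ℕ, ((u, v) ∈ nest p b N ++ flipUp h (nest q b 2) ∨
          (v, u) ∈ nest p b N ++ flipUp h (nest q b 2)) ∧ (v : ZMod (2 * h)) = u + d := by
      by_cases h1 : i < c ∨ c + L + n ≤ i
      · rcases hcov i hi0 (by omega) h1 d hdi with h3 | h3
        · exact Or.inl (List.mem_append_left _ h3)
        · exact Or.inr (Or.inl (h3.mono fun e he => List.mem_append_right _ he))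
      · by_cases h3 : i < c + L
        · refine Or.inr (Or.inr ?_)
          rcases Nat.mod_two_eq_zero_or_one i with hi2 | hi2
          · obtain ⟨u, hu⟩ := mem_nest (b := q) (lo := b) (M := 2) (j := (i - 2) / 2) (by omega)
            rw [show 2 + 2 * ((i - 2) / 2) = i by omega] at hu
            exact exists_edge_of_mem (x := u + h) (y := u + i + h)
              (Or.inr (List.mem_append_right _ (List.mem_map.2 ⟨_, hu, rfl⟩)))
              (by push_cast; ring) hdi
          · obtain ⟨u, hu⟩ := mem_nest (b := p) (lo := b) (M := N) (j := (i - N) / 2) (by omega)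
            rw [show N + 2 * ((i - N) / 2) = i by omega] at hu
            exact exists_edge_of_mem (Or.inl (List.mem_append_left _ hu)) (by push_cast; ring) hdi
        · by_cases h4 : i % 2 = 0 ∧ M ≤ i ∧ i < M + 2 * b
          · have := covers_nest (t := 2 * h) (Q := []) (lo := 0) (h := h)
              (E := nest b 0 M ++ flipUp h (nest b 0 M) ++ X)
              (fun e he => List.mem_append_left _ (List.mem_append_left _ he))
              (fun e he => List.mem_append_left _ (List.mem_append_right _ he)) hM2 h4.1 h4.2.1
              h4.2.2
            refine Or.inr (Or.inl ?_)
            rcases hdi with rfl | rfl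
            · exact this.1
            · exact this.2
          · have := mem_plusMinus (t := 2 * h)
              (mem_rest (b := b) (M := M) (lo := c + L) (n := n).2 ⟨⟨by omega, by omega⟩, h4⟩)
            refine Or.inl (List.mem_append_right _ ?_)
            rcases hdi with rfl | rfl
            · exact this.1
            · exact this.2
    rcases key with h3 | ⟨u, v, h3 | ⟨P, hP, -⟩, h4⟩ | ⟨u, v, h3, h4⟩
    · exact Or.inl h3
    · exact Or.inr ⟨u, v, Or.inl h3, h4⟩
    · exact absurd hP List.not_mem_nil
    · exact Or.inr ⟨u, v, Or.inr h3, h4⟩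

variable (m : List ℕ) (h2 : ∀ x ∈ m, 2 ≤ x) (hsol : HasOPSolution m)
include h2 hsol

theorem hasOPSolution_append_twos_odd (h : ℕ) (ht : m.sum < 2 * h)
    (ha : (m.filter (fun x => x % 2 = 1)).length ≤ 2 * h - m.sum) (hodd : m.sum % 2 = 1) :
    HasOPSolution (m ++ List.replicate (2 * h / 2) 2) := by
  have h3 := three_mul_odd_le m h2
  have hpar := length_filter_odd_mod_two m
  have : NeZero (2 * h) := ⟨by omega⟩
  obtain ⟨b, hb⟩ : ∃ b, (m.filter (fun x => x % 2 = 1)).length = 2 * b + 1 :=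
    ⟨(m.filter (fun x => x % 2 = 1)).length / 2, by omega⟩
  obtain ⟨r, hr⟩ : ∃ r, m.sum = 2 * r + 1 := ⟨m.sum / 2, by omega⟩
  obtain ⟨L, hL⟩ : ∃ L, L + b + r + 1 = h := ⟨h - (b + r + 1), by omega⟩
  rcases Nat.mod_two_eq_zero_or_one r with hr2 | hr2
  · obtain ⟨M, hM2, hM, hM'⟩ := exists_even_between (1 + L)
    refine hasOPSolution_append_twos_of_layout m h2 h (by omega) hsol (c := 1) (L := L) (b := b)
      (M := M) (N := 1) (n := h - 1 - L) (p := (L + 1) / 2) (q := L / 2) [(h - 1, h - 1 + h)]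
      (by omega) (by omega) (by omega) (by omega) (by omega) (by omega) (by omega)
      (by omega) (by omega) hM hM2 (by omega)
      (nodup_ends_singleton (by omega)) ?_ ?_ ?_ hb.symm ?_ [] (Factorable.nil _ _) (by omega)
      (by omega) (by omega) ?_ ?_
    · intro x hx
      rw [mem_ends_singleton] at hx
      omega
    · intro x hx
      rw [mem_ends_singleton] at hx
      unfold NestOccupied
      omega
    · intro x hx
      rw [mem_ends_singleton] at hx
      unfold NestOccupied
      omega
    · simp only [List.length_cons, List.length_nil]
      omega
    · simp only [List.length_nil]
      omega
    · intro i hi0 hi hic d hd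
      obtain rfl : i = h := by omega
      rw [← half_eq_neg, or_self] at hd
      exact Or.inr (covers_edge List.mem_cons_self (by rw [hd]; push_cast; ring))
  · obtain ⟨M, hM2, hM, hM'⟩ := exists_even_between (2 + L)
    refine hasOPSolution_append_twos_of_layout m h2 h (by omega) hsol (c := 2) (L := L) (b := b)
      (M := M) (N := 3) (n := h - 2 - L) (p := L / 2) (q := (L + 1) / 2)
      [(b + (L + 1) / 2, b + (L + 1) / 2 + h)]
      (by omega) (by omega) (by omega) (by omega) (by omega) (by omega) (by omega)
      (by omega) (by omega) hM hM2 (by omega)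
      (nodup_ends_singleton (by omega)) ?_ ?_ ?_ hb.symm ?_ _
      (factorable_unit_pair (Or.inr ⟨even_two_mul h, rfl⟩) (by omega) isUnit_one) (by omega)
      (by omega) (by omega) ?_ ?_
    · intro x hx
      rw [mem_ends_singleton] at hx
      omega
    · intro x hx
      rw [mem_ends_singleton] at hx
      unfold NestOccupied
      omega
    · intro x hx
      rw [mem_ends_singleton] at hx
      unfold NestOccupied
      omega
    · simp only [List.length_cons, List.length_nil]
      omega
    · simp only [List.length_cons, List.length_nil]
      omega
    · intro i hi0 hi hic d hd
      rcases (by omega : i = h ∨ i = 1) with rfl | rfl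
      · rw [← half_eq_neg, or_self] at hd
        exact Or.inr (covers_edge List.mem_cons_self (by rw [hd]; push_cast; ring))
      · exact Or.inl (by simpa using hd)

theorem hasOPSolution_append_twos_even (h : ℕ) (ht : m.sum < 2 * h)
    (ha : (m.filter (fun x => x % 2 = 1)).length ≤ 2 * h - m.sum) (hs : 0 < m.sum)
    (heven : m.sum % 2 = 0) : HasOPSolution (m ++ List.replicate (2 * h / 2) 2) := by
  have h3 := three_mul_odd_le m h2
  have hpar := length_filter_odd_mod_two m
  have : NeZero (2 * h) := ⟨by omega⟩
  obtain ⟨b, hb⟩ : ∃ b, (m.filter (fun x => x % 2 = 1)).length = 2 * b :=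
    ⟨(m.filter (fun x => x % 2 = 1)).length / 2, by omega⟩
  obtain ⟨r, hr⟩ : ∃ r, m.sum = 2 * (r + 1) := ⟨m.sum / 2 - 1, by omega⟩
  obtain ⟨L, hL⟩ : ∃ L, L + b + r + 1 = h := ⟨h - (b + r + 1), by omega⟩
  have hhalf := factorable_half h rfl
  rcases Nat.mod_two_eq_zero_or_one r with hr2 | hr2
  · obtain ⟨M, hM2, hM, hM'⟩ := exists_even_between (1 + L)
    refine hasOPSolution_append_twos_of_layout m h2 h hs hsol (c := 1) (L := L) (b := b)
      (M := M) (N := 1) (n := h - 1 - L) (p := (L + 1) / 2) (q := L / 2) []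
      (by omega) (by omega) (by omega) (by omega) (by omega) (by omega) (by omega)
      (by omega) (by omega) hM hM2 (by omega)
      List.nodup_nil (by simp [ends]) (by simp [ends]) (by simp [ends]) hb.symm ?_ _ hhalf
      (by omega) (by omega) (by omega) ?_ ?_
    · simp only [List.length_nil]
      omega
    · simp only [List.length_cons, List.length_nil]
      omega
    · intro i hi0 hi hic d hd
      obtain rfl : i = h := by omega
      rw [← half_eq_neg, or_self] at hd
      exact Or.inl (by simp [hd])
  · obtain ⟨M, hM2, hM, hM'⟩ := exists_even_between (2 + L)
    refine hasOPSolution_append_twos_of_layout m h2 h hs hsol (c := 2) (L := L) (b := b)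
      (M := M) (N := 3) (n := h - 2 - L) (p := L / 2) (q := (L + 1) / 2) []
      (by omega) (by omega) (by omega) (by omega) (by omega) (by omega) (by omega)
      (by omega) (by omega) hM hM2 (by omega)
      List.nodup_nil (by simp [ends]) (by simp [ends]) (by simp [ends]) hb.symm ?_ _
      (hhalf.append (factorable_unit_pair (Or.inr ⟨even_two_mul h, rfl⟩) (by omega) isUnit_one))
      (by omega) (by omega) (by omega) ?_ ?_
    · simp only [List.length_nil]
      omega
    · simp only [List.length_cons, List.length_nil, List.length_append]
      omega
    · intro i hi0 hi hic d hd
      rcases (by omega : i = h ∨ i = 1) with rfl | rfl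
      · rw [← half_eq_neg, or_self] at hd
        exact Or.inl (by simp [hd])
      · rw [Nat.cast_one] at hd
        rcases hd with rfl | rfl <;> exact Or.inl (by simp)

end Oberwolfach

/-- Theorem (main extension result): a solution to OP*(m₁,…,m_ℓ) extends to
OP*(m₁,…,m_ℓ,t) and, for even t, to OP*(m₁,…,m_ℓ,2^⟨t/2⟩), provided
a ≤ 2⌊t/2⌋ − s where s is the total length and a the number of odd lengths. -/
theorem stmt1 (ℓ : ℕ) (hℓ : 1 ≤ ℓ) (m : List ℕ) (hlen : m.length = ℓ)
    (h2 : ∀ x ∈ m, 2 ≤ x) (t : ℕ) (ht : m.sum < t)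
    (ha : (m.filter (fun x => x % 2 = 1)).length ≤ 2 * (t / 2) - m.sum)
    (hsol : HasOPSolution m) :
    HasOPSolution (m ++ [t]) ∧
      (Even t → HasOPSolution (m ++ List.replicate (t / 2) 2)) := by
  have hs : 0 < m.sum := by
    obtain ⟨x, hx⟩ := List.exists_mem_of_length_pos (by omega : 0 < m.length)
    have := h2 x hx
    have := List.le_sum_of_mem hx
    omega
  have h3 := Oberwolfach.three_mul_odd_le m h2
  obtain ⟨h, rfl | rfl⟩ : ∃ h, t = 2 * h ∨ t = 2 * h + 1 := ⟨t / 2, by omega⟩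
  · rw [show 2 * h / 2 = h by omega] at ha
    rcases Nat.mod_two_eq_zero_or_one m.sum with hpar | hpar
    · refine ⟨?_, fun _ => Oberwolfach.hasOPSolution_append_twos_even m h2 hsol h ht ha hs hpar⟩
      by_cases hh : m.sum % 4 = 2 ∨ h % 2 = 0
      · exact Oberwolfach.hasOPSolution_append_singleton_even_even m h2 hsol h ht ha hs hpar hh
      · exact Oberwolfach.hasOPSolution_append_singleton_even_even_of_odd m h2 hsol h ht ha hs
          (by omega) (by omega)
    · exact ⟨Oberwolfach.hasOPSolution_append_singleton_even_odd m h2 hsol h ht ha hpar,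
        fun _ => Oberwolfach.hasOPSolution_append_twos_odd m h2 hsol h ht ha hpar⟩
  · refine ⟨?_, fun he => absurd he (Nat.not_even_iff_odd.2 (odd_two_mul_add_one h))⟩
    rw [show (2 * h + 1) / 2 = h by omega] at ha
    rcases Nat.mod_two_eq_zero_or_one m.sum with hpar | hpar
    · exact Oberwolfach.hasOPSolution_append_singleton_odd_even m h2 hsol h ht ha hs hpar
    · have hodd := Oberwolfach.length_filter_odd_mod_two m
      obtain ⟨r, hr⟩ : ∃ r, m.sum = 2 * r + 1 := ⟨m.sum / 2, by omega⟩
      rcases Nat.mod_two_eq_zero_or_one r with hr2 | hr2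
      · exact Oberwolfach.hasOPSolution_append_singleton_odd_odd_of_even m h2 hsol h r hr hr2
          (by omega) ht ha
      · rcases (by omega : 3 ≤ r ∨ m.sum = 3 ∧ h = 2 ∨ m.sum = 3 ∧ 3 ≤ h) with
          hr3 | ⟨hr3, rfl⟩ | ⟨hr3, hh⟩
        · exact Oberwolfach.hasOPSolution_append_singleton_odd_odd_of_odd m h2 hsol h r hr hr2 hr3
            ht ha
        · exact Oberwolfach.hasOPSolution_append_singleton_five m h2 hsol hr3
        · exact Oberwolfach.hasOPSolution_append_singleton_odd_three m h2 hsol h hr3 hh
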